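/- Suppose α' satisfies β2'(+∞) ≤ α' < β2'(1) and there exists s1 ∈ [0,1] with β2^*(α') = s1·α' − β1(s1) (i.e. the tangent line y = s1·x − β1(s1) to the graph of β1^* at the point of tangency g(α') := β1'(s1) passes through (α', β2^*(α'))). Then for every α with β1'(s1) ≤ α < β1'(0), dim_H E(μ,α,α') = min{ log 2/log A, s1·α − β1(s1) }. -/

import Mathlib

open MeasureTheory Filter Set Metric Topology

/-- `moranCyl c w n (x, ℓ)` refines the interval `[x, x + ℓ]` along the binary word `w`,
using the contraction ratio `c k` at step `k` (the first letter of `w` is processed with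
index `n`).  The result `(x', ℓ')` describes the interval `[x', x' + ℓ']`. -/
noncomputable def moranCyl (c : ℕ → ℝ) : List Bool → ℕ → ℝ × ℝ → ℝ × ℝ
  | [], _, st => st
  | bb :: w, n, st =>
      moranCyl c w (n + 1)
        (if bb then (st.1 + st.2 - st.2 / c n, st.2 / c n) else (st.1, st.2 / c n))

/-- The basic interval `I_w` of the Moran construction with ratios `c`. -/
noncomputable def moranI (c : ℕ → ℝ) (w : List Bool) : Set ℝ :=
  Icc (moranCyl c w 1 (0, 1)).1 ((moranCyl c w 1 (0, 1)).1 + (moranCyl c w 1 (0, 1)).2)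

/-- The length `|I_w|` of the basic interval `I_w`. -/
noncomputable def moranLen (c : ℕ → ℝ) (w : List Bool) : ℝ :=
  (moranCyl c w 1 (0, 1)).2

/-- The Moran set `⋂ n ⋃ {I_w : |w| = n}`. -/
noncomputable def moranSet (c : ℕ → ℝ) : Set ℝ :=
  ⋂ n : ℕ, ⋃ w ∈ {w : List Bool | w.length = n}, moranI c w

/-- The mass assigned to the cylinder `I_w` by the Moran measure with weight `r k` for the
letter at step `k`: `cylMass r w 1 1 = μ(I_w)`. -/
noncomputable def cylMass (r : ℕ → ℝ) : List Bool → ℕ → ℝ → ℝ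
  | [], _, m => m
  | bb :: w, n, m => cylMass r w (n + 1) (if bb then (1 - r n) * m else r n * m)

/-- Lower local dimension `liminf_{r → 0⁺} log μ(B(x,r)) / log r`. -/
noncomputable def lowerLocalDim (μ : Measure ℝ) (x : ℝ) : ℝ :=
  liminf (fun rr : ℝ => Real.log (μ (closedBall x rr)).toReal / Real.log rr) (𝓝[>] 0)

/-- Upper local dimension `limsup_{r → 0⁺} log μ(B(x,r)) / log r`. -/
noncomputable def upperLocalDim (μ : Measure ℝ) (x : ℝ) : ℝ :=
  limsup (fun rr : ℝ => Real.log (μ (closedBall x rr)).toReal / Real.log rr) (𝓝[>] 0)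

/-- `betaFn ρ C s = -log (ρ^s + (1-ρ)^s) / log C`; so `β₁ = betaFn p A`, `β₂ = betaFn q B`. -/
noncomputable def betaFn (ρ C : ℝ) (s : ℝ) : ℝ :=
  -Real.log (ρ ^ s + (1 - ρ) ^ s) / Real.log C

/-- The Legendre transform `f^*(α) = inf_s (s α - f(s))`. -/
noncomputable def legendre (f : ℝ → ℝ) (α : ℝ) : ℝ :=
  ⨅ s : ℝ, (s * α - f s)

/-- The modification `β̃₁` of `β₁`, linear on `(0,1)`. -/
noncomputable def betaTilde1 (ρ C : ℝ) (s : ℝ) : ℝ :=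
  if s ≤ 0 ∨ 1 ≤ s then betaFn ρ C s
  else (1 - s) * betaFn ρ C 0 + s * betaFn ρ C 1

/-- `packSup μ X r s` is the supremum of `∑ᵢ μ(B(xᵢ,r))^s` over all finite families of
pairwise disjoint closed balls of radius `r` with centers in `X`. -/
noncomputable def packSup (μ : Measure ℝ) (X : Set ℝ) (rr s : ℝ) : ℝ :=
  sSup {y : ℝ | ∃ t : Finset ℝ, (↑t : Set ℝ) ⊆ X ∧
    (↑t : Set ℝ).Pairwise (fun u v => Disjoint (closedBall u rr) (closedBall v rr)) ∧
    y = ∑ u ∈ t, (μ (closedBall u rr)).toReal ^ s}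

namespace Moran

section

variable {A B : ℝ} {c r : ℕ → ℝ}

/-- `logScale c n = -log` of the common length of the basic intervals of level `n`. -/
noncomputable def logScale (c : ℕ → ℝ) (n : ℕ) : ℝ := ∑ k ∈ Finset.range n, Real.log (c (k + 1))

/-- The common length of the basic intervals of level `n`. -/
noncomputable def scale (c : ℕ → ℝ) (n : ℕ) : ℝ := Real.exp (-logScale c n)

/-- The left endpoint of the basic interval of level `n` determined by `ω`. -/
noncomputable def leftPt (c : ℕ → ℝ) (n : ℕ) (ω : ℕ → Bool) : ℝ :=
  ∑ k ∈ Finset.range n, if ω k then scale c k - scale c (k + 1) else 0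

/-- The point of the Moran set with address `ω`. -/
noncomputable def point (c : ℕ → ℝ) (ω : ℕ → Bool) : ℝ :=
  ∑' k, if ω k then scale c k - scale c (k + 1) else 0

/-- The word of length `n` which is a prefix of `ω`. -/
def pref (n : ℕ) (ω : ℕ → Bool) : List Bool := (List.range n).map ω

/-- `-log` of the weight of the letter `b` at step `k + 1`. -/
noncomputable def info (r : ℕ → ℝ) (k : ℕ) (b : Bool) : ℝ :=
  -Real.log (if b then 1 - r (k + 1) else r (k + 1))

/-- `-log` of the mass of the basic interval of level `n` determined by `ω`. -/
noncomputable def logMass (r : ℕ → ℝ) (n : ℕ) (ω : ℕ → Bool) : ℝ :=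
  ∑ k ∈ Finset.range n, info r k (ω k)

lemma logScale_succ (c : ℕ → ℝ) (n : ℕ) :
    logScale c (n + 1) = logScale c n + Real.log (c (n + 1)) := by
  simp [logScale, Finset.sum_range_succ]

lemma logMass_succ (r : ℕ → ℝ) (n : ℕ) (ω : ℕ → Bool) :
    logMass r (n + 1) ω = logMass r n ω + info r n (ω n) := by
  simp [logMass, Finset.sum_range_succ]

lemma leftPt_succ (c : ℕ → ℝ) (n : ℕ) (ω : ℕ → Bool) :
    leftPt c (n + 1) ω = leftPt c n ω + if ω n then scale c n - scale c (n + 1) else 0 := by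
  simp [leftPt, Finset.sum_range_succ]

lemma scale_pos (c : ℕ → ℝ) (n : ℕ) : 0 < scale c n := Real.exp_pos _

lemma scale_zero (c : ℕ → ℝ) : scale c 0 = 1 := by simp [scale, logScale]

lemma scale_succ {n : ℕ} (hc : 0 < c (n + 1)) : scale c (n + 1) = scale c n / c (n + 1) := by
  rw [scale, logScale_succ, neg_add, Real.exp_add, Real.exp_neg (Real.log _), Real.exp_log hc]
  rfl

lemma pref_succ (n : ℕ) (ω : ℕ → Bool) : pref (n + 1) ω = pref n ω ++ [ω n] := by
  simp [pref, List.range_succ]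

lemma length_pref (n : ℕ) (ω : ℕ → Bool) : (pref n ω).length = n := by simp [pref]

lemma exists_pref (w : List Bool) : ∃ ω, pref w.length ω = w := by
  refine ⟨fun k => w.getD k false, ?_⟩
  apply List.ext_getElem
  · simp [pref]
  · intro i h1 h2
    simp [pref, h2]

lemma pref_congr {n : ℕ} {ω ω' : ℕ → Bool} : pref n ω = pref n ω' ↔ ∀ k < n, ω k = ω' k := by
  simp [pref]

lemma moranCyl_append (c : ℕ → ℝ) (u v : List Bool) (n : ℕ) (st : ℝ × ℝ) :
    moranCyl c (u ++ v) n st = moranCyl c v (n + u.length) (moranCyl c u n st) := by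
  induction u generalizing n st with
  | nil => simp [moranCyl]
  | cons b u ih =>
    rw [List.cons_append, moranCyl, ih, moranCyl, List.length_cons]
    congr 1
    omega

lemma cylMass_append (r : ℕ → ℝ) (u v : List Bool) (n : ℕ) (m : ℝ) :
    cylMass r (u ++ v) n m = cylMass r v (n + u.length) (cylMass r u n m) := by
  induction u generalizing n m with
  | nil => simp [cylMass]
  | cons b u ih =>
    rw [List.cons_append, cylMass, ih, cylMass, List.length_cons]
    congr 1
    omega

lemma moranCyl_pref (hc : ∀ k, 0 < c (k + 1)) (n : ℕ) (ω : ℕ → Bool) :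
    moranCyl c (pref n ω) 1 (0, 1) = (leftPt c n ω, scale c n) := by
  induction n with
  | zero => simp [pref, moranCyl, leftPt, scale_zero]
  | succ n ih =>
    rw [pref_succ, moranCyl_append, ih, length_pref, moranCyl, moranCyl, leftPt_succ,
      scale_succ (hc n), add_comm 1 n]
    split_ifs <;> simp
    ring

lemma cylMass_pref (hr : ∀ k, 0 < r (k + 1) ∧ r (k + 1) < 1) (n : ℕ) (ω : ℕ → Bool) :
    cylMass r (pref n ω) 1 1 = Real.exp (-logMass r n ω) := by
  induction n with
  | zero => simp [pref, cylMass, logMass]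
  | succ n ih =>
    rw [pref_succ, cylMass_append, ih, length_pref, cylMass, cylMass, logMass_succ,
      add_comm 1 n, neg_add, Real.exp_add, info, neg_neg, Real.exp_log, mul_comm]
    · split_ifs <;> ring
    · have := hr n
      split_ifs <;> linarith

lemma moranI_pref (hc : ∀ k, 0 < c (k + 1)) (n : ℕ) (ω : ℕ → Bool) :
    moranI c (pref n ω) = Icc (leftPt c n ω) (leftPt c n ω + scale c n) := by
  rw [moranI, moranCyl_pref hc]

section Bounds

variable (hB2 : 2 < B) (hcB : ∀ k, B ≤ c (k + 1))
include hB2 hcB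

lemma ratio_pos (k : ℕ) : 0 < c (k + 1) := by linarith [hcB k]

lemma scale_succ_le (n : ℕ) : scale c (n + 1) ≤ scale c n / B := by
  rw [scale_succ (ratio_pos hB2 hcB n)]
  exact div_le_div_of_nonneg_left (scale_pos c n).le (by linarith) (hcB n)

lemma two_mul_scale_succ_le (n : ℕ) : 2 * scale c (n + 1) ≤ scale c n := by
  have h := scale_succ_le hB2 hcB n
  rw [le_div_iff₀ (by linarith)] at h
  nlinarith [scale_pos c (n + 1)]

lemma scale_antitone : Antitone (scale c) :=
  antitone_nat_of_succ_le fun n => by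
    linarith [two_mul_scale_succ_le hB2 hcB n, scale_pos c (n + 1)]

lemma scale_add_le (n k : ℕ) : 2 ^ k * scale c (n + k) ≤ scale c n := by
  induction k with
  | zero => simp
  | succ k ih =>
    have := two_mul_scale_succ_le hB2 hcB (n + k)
    rw [← add_assoc, pow_succ, mul_assoc]
    exact (mul_le_mul_of_nonneg_left this (by positivity)).trans ih

lemma scale_le_pow (n : ℕ) : scale c n ≤ (1 / 2) ^ n := by
  have := scale_add_le hB2 hcB 0 n
  rw [zero_add, scale_zero] at this
  rw [one_div, inv_pow, ← one_div, le_div_iff₀ (by positivity)]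
  linarith

lemma tendsto_scale : Tendsto (scale c) atTop (𝓝 0) :=
  squeeze_zero (fun n => (scale_pos c n).le) (scale_le_pow hB2 hcB)
    (tendsto_pow_atTop_nhds_zero_of_lt_one (by norm_num) (by norm_num))

lemma leftPt_mono (ω : ℕ → Bool) : Monotone fun n => leftPt c n ω :=
  monotone_nat_of_le_succ fun n => by
    have := scale_antitone hB2 hcB (Nat.le_succ n)
    rw [leftPt_succ]
    split_ifs <;> simp [this]

lemma rightPt_anti (ω : ℕ → Bool) : Antitone fun n => leftPt c n ω + scale c n :=
  antitone_nat_of_succ_le fun n => by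
    have := scale_antitone hB2 hcB (Nat.le_succ n)
    simp only [leftPt_succ]
    split_ifs <;> (simp at this ⊢; linarith)

lemma summable_digits (ω : ℕ → Bool) :
    Summable fun k => if ω k then scale c k - scale c (k + 1) else 0 := by
  refine Summable.of_nonneg_of_le (g := _) (f := fun k => ((1 : ℝ) / 2) ^ k) ?_ ?_
    (summable_geometric_of_lt_one (by norm_num) (by norm_num))
  · intro k
    have := scale_antitone hB2 hcB (Nat.le_succ k)
    split_ifs <;> simp at this ⊢ <;> linarith
  · intro k
    have h1 := scale_le_pow hB2 hcB k
    have h2 := scale_pos c (k + 1)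
    have h3 : (0 : ℝ) ≤ (1 / 2) ^ k := by positivity
    split_ifs <;> linarith

lemma tendsto_leftPt (ω : ℕ → Bool) : Tendsto (fun n => leftPt c n ω) atTop (𝓝 (point c ω)) :=
  (summable_digits hB2 hcB ω).hasSum.tendsto_sum_nat

lemma point_mem (n : ℕ) (ω : ℕ → Bool) :
    point c ω ∈ Icc (leftPt c n ω) (leftPt c n ω + scale c n) := by
  constructor
  · exact (leftPt_mono hB2 hcB ω).ge_of_tendsto (tendsto_leftPt hB2 hcB ω) n
  · have := (tendsto_leftPt hB2 hcB ω).add (tendsto_scale hB2 hcB)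
    rw [add_zero] at this
    exact (rightPt_anti hB2 hcB ω).le_of_tendsto this n

lemma continuous_point : Continuous (point c) := by
  refine continuous_tsum (u := fun k => ((1 : ℝ) / 2) ^ k) ?_
    (summable_geometric_of_lt_one (by norm_num) (by norm_num)) ?_
  · intro k
    exact (continuous_of_discreteTopology (f := fun b : Bool =>
      if b then scale c k - scale c (k + 1) else 0)).comp (continuous_apply k)
  · intro k ω
    have h0 := scale_antitone hB2 hcB (Nat.le_succ k)
    have h1 := scale_le_pow hB2 hcB k
    have h2 := scale_pos c (k + 1)
    have h3 : (0 : ℝ) ≤ (1 / 2) ^ k := by positivity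
    rw [Real.norm_eq_abs, abs_le]
    split_ifs <;> constructor <;> simp at h0 h1 h3 ⊢ <;> linarith

/-- Points in basic intervals whose addresses first differ at the place `j` are separated. -/
lemma separation {ω ω' : ℕ → Bool} {j n m : ℕ} (hn : j < n) (hm : j < m)
    (heq : ∀ k < j, ω k = ω' k) (hne : ω j ≠ ω' j) {y y' : ℝ}
    (hy : y ∈ Icc (leftPt c n ω) (leftPt c n ω + scale c n))
    (hy' : y' ∈ Icc (leftPt c m ω') (leftPt c m ω' + scale c m)) :
    (1 - 2 / B) * scale c j ≤ |y - y'| := by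
  have hl : leftPt c j ω = leftPt c j ω' := by
    apply Finset.sum_congr rfl
    intro k hk
    rw [heq k (Finset.mem_range.1 hk)]
  have hs : 2 * scale c (j + 1) ≤ 2 / B * scale c j := by
    have := scale_succ_le hB2 hcB j
    calc 2 * scale c (j + 1) ≤ 2 * (scale c j / B) := by linarith
      _ = _ := by ring
  have h1 : leftPt c (j + 1) ω ≤ y := (leftPt_mono hB2 hcB ω hn).trans hy.1
  have h2 : y ≤ leftPt c (j + 1) ω + scale c (j + 1) := hy.2.trans (rightPt_anti hB2 hcB ω hn)
  have h1' : leftPt c (j + 1) ω' ≤ y' := (leftPt_mono hB2 hcB ω' hm).trans hy'.1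
  have h2' : y' ≤ leftPt c (j + 1) ω' + scale c (j + 1) :=
    hy'.2.trans (rightPt_anti hB2 hcB ω' hm)
  rw [leftPt_succ] at h1 h2 h1' h2'
  rw [← hl] at h1' h2'
  rw [le_abs]
  cases hω : ω j <;> cases hω' : ω' j <;> simp [hω, hω'] at h1 h2 h1' h2' hne
  · right; linarith
  · left; linarith

omit hcB in
lemma gap_pos : 0 < 1 - 2 / B := by
  rw [sub_pos, div_lt_one (by linarith)]; exact hB2

/-- Points closer than the gap at level `n` have the same address up to level `n`. -/
lemma eq_of_dist_lt {ω ω' : ℕ → Bool} {j n m : ℕ} (hn : j < n) (hm : j < m) {y y' : ℝ}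
    (hy : y ∈ Icc (leftPt c n ω) (leftPt c n ω + scale c n))
    (hy' : y' ∈ Icc (leftPt c m ω') (leftPt c m ω' + scale c m))
    (hd : |y - y'| < (1 - 2 / B) * scale c j) : ∀ k ≤ j, ω k = ω' k := by
  intro k
  induction k using Nat.strong_induction_on with
  | _ k ih =>
    intro hk
    by_contra hne
    have := separation hB2 hcB (lt_of_le_of_lt hk hn) (lt_of_le_of_lt hk hm)
      (fun i hi => ih i hi (hi.le.trans hk)) hne hy hy'
    have h2 := mul_le_mul_of_nonneg_left (scale_antitone hB2 hcB hk) (gap_pos hB2).le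
    linarith

lemma eq_of_mem {ω ω' : ℕ → Bool} {n m : ℕ} (hnm : n ≤ m) {y : ℝ}
    (hy : y ∈ Icc (leftPt c n ω) (leftPt c n ω + scale c n))
    (hy' : y ∈ Icc (leftPt c m ω') (leftPt c m ω' + scale c m)) : ∀ k < n, ω k = ω' k := by
  intro k hk
  refine eq_of_dist_lt hB2 hcB hk (hk.trans_le hnm) hy hy' ?_ k le_rfl
  simpa using mul_pos (gap_pos hB2) (scale_pos c k)

lemma mem_moranSet_iff {x : ℝ} : x ∈ moranSet c ↔ ∃ ω, point c ω = x := by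
  have hpos := ratio_pos hB2 hcB
  constructor
  · intro hx
    have h : ∀ n, ∃ ω, x ∈ Icc (leftPt c n ω) (leftPt c n ω + scale c n) := by
      intro n
      have := mem_iInter.1 hx n
      simp only [mem_iUnion, mem_ofPred_eq, exists_prop] at this
      obtain ⟨w, rfl, hw⟩ := this
      obtain ⟨ω, hω⟩ := exists_pref w
      exact ⟨ω, by rwa [← moranI_pref hpos, hω]⟩
    choose f hf using h
    let ω : ℕ → Bool := fun k => f (k + 1) k
    have hω : ∀ n, leftPt c n ω = leftPt c n (f n) := by
      intro n
      apply Finset.sum_congr rfl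
      intro k hk
      rw [← eq_of_mem hB2 hcB (Finset.mem_range.1 hk) (hf (k + 1)) (hf n) k (Nat.lt_succ_self k)]
    refine ⟨ω, ?_⟩
    refine tendsto_nhds_unique (tendsto_leftPt hB2 hcB ω) ?_
    have hl : Tendsto (fun n => x - scale c n) atTop (𝓝 x) := by
      simpa using tendsto_const_nhds.sub (tendsto_scale hB2 hcB)
    refine tendsto_of_tendsto_of_tendsto_of_le_of_le hl tendsto_const_nhds ?_ ?_
    · intro n
      have := (hf n).2
      simp only [hω]
      linarith
    · intro n
      have := (hf n).1
      simpa only [hω]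
  · rintro ⟨ω, rfl⟩
    refine mem_iInter.2 fun n => ?_
    simp only [mem_iUnion, mem_ofPred_eq, exists_prop]
    exact ⟨pref n ω, length_pref n ω, by rw [moranI_pref hpos]; exact point_mem hB2 hcB n ω⟩

lemma logScale_ge (n : ℕ) : n * Real.log B ≤ logScale c n := by
  have : ∑ k ∈ Finset.range n, Real.log B ≤ logScale c n :=
    Finset.sum_le_sum fun k _ => Real.log_le_log (by linarith) (hcB k)
  simpa using this

lemma logScale_le (hcA : ∀ k, c (k + 1) ≤ A) (n : ℕ) : logScale c n ≤ n * Real.log A := by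
  have : logScale c n ≤ ∑ k ∈ Finset.range n, Real.log A :=
    Finset.sum_le_sum fun k _ => Real.log_le_log (ratio_pos hB2 hcB k) (hcA k)
  simpa using this

lemma logScale_mono : Monotone (logScale c) :=
  monotone_nat_of_le_succ fun n => by
    rw [logScale_succ]
    linarith [Real.log_nonneg (x := c (n + 1)) (by linarith [hcB n])]

end Bounds

end

section

variable {A B : ℝ} {c r : ℕ → ℝ}

section Liminf

variable {ι : Type*} {l : Filter ι} {u v : ι → ℝ} {C : ℝ}

lemma isBoundedUnder_le_of_abs (h : ∀ᶠ i in l, |u i| ≤ C) : l.IsBoundedUnder (· ≤ ·) u :=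
  isBoundedUnder_of_eventually_le (a := C) (h.mono fun _ hi => (abs_le.1 hi).2)

lemma isBoundedUnder_ge_of_abs (h : ∀ᶠ i in l, |u i| ≤ C) : l.IsBoundedUnder (· ≥ ·) u :=
  isBoundedUnder_of_eventually_ge (a := -C) (h.mono fun _ hi => (abs_le.1 hi).1)

lemma limsup_le_of_sub [l.NeBot] (hu : ∀ᶠ i in l, |u i| ≤ C) (hv : ∀ᶠ i in l, |v i| ≤ C)
    (h : Tendsto (fun i => u i - v i) l (𝓝 0)) : limsup u l ≤ limsup v l := by
  refine le_of_forall_pos_le_add fun ε hε => ?_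
  have h1 : ∀ᶠ i in l, v i < limsup v l + ε / 2 :=
    eventually_lt_of_limsup_lt (by linarith) (isBoundedUnder_le_of_abs hv)
  have h2 : ∀ᶠ i in l, u i - v i < ε / 2 := h.eventually (gt_mem_nhds (by linarith))
  refine limsup_le_of_le (isBoundedUnder_ge_of_abs hu).isCoboundedUnder_le ?_
  filter_upwards [h1, h2] with i h1 h2
  linarith

lemma liminf_le_of_sub [l.NeBot] (hu : ∀ᶠ i in l, |u i| ≤ C) (hv : ∀ᶠ i in l, |v i| ≤ C)
    (h : Tendsto (fun i => u i - v i) l (𝓝 0)) : liminf v l ≤ liminf u l := by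
  refine le_of_forall_pos_le_add fun ε hε => ?_
  have h1 : ∀ᶠ i in l, liminf v l - ε / 2 < v i :=
    eventually_lt_of_lt_liminf (by linarith) (isBoundedUnder_ge_of_abs hv)
  have h2 : ∀ᶠ i in l, -(ε / 2) < u i - v i := h.eventually (lt_mem_nhds (by linarith))
  rw [← sub_le_iff_le_add]
  refine le_liminf_of_le (isBoundedUnder_le_of_abs hu).isCoboundedUnder_ge ?_
  filter_upwards [h1, h2] with i h1 h2
  linarith

lemma limsup_eq_of_sub [l.NeBot] (hu : ∀ᶠ i in l, |u i| ≤ C) (hv : ∀ᶠ i in l, |v i| ≤ C)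
    (h : Tendsto (fun i => u i - v i) l (𝓝 0)) : limsup u l = limsup v l :=
  le_antisymm (limsup_le_of_sub hu hv h) (limsup_le_of_sub hv hu (by simpa using h.neg))

lemma liminf_eq_of_sub [l.NeBot] (hu : ∀ᶠ i in l, |u i| ≤ C) (hv : ∀ᶠ i in l, |v i| ≤ C)
    (h : Tendsto (fun i => u i - v i) l (𝓝 0)) : liminf u l = liminf v l :=
  le_antisymm (liminf_le_of_sub hv hu (by simpa using h.neg)) (liminf_le_of_sub hu hv h)

lemma comp_bounds {κ : Type*} {f : Filter κ} [f.NeBot] {φ : κ → ι} (hφ : Tendsto φ f l)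
    (hu : ∀ᶠ i in l, |u i| ≤ C) :
    liminf u l ≤ liminf (fun k => u (φ k)) f ∧ limsup (fun k => u (φ k)) f ≤ limsup u l := by
  have h : ∀ᶠ i in map φ f, |u i| ≤ C := hφ.eventually hu
  exact ⟨hφ.liminf_le_liminf_comp (isBoundedUnder_le_of_abs h).isCoboundedUnder_ge
    (isBoundedUnder_ge_of_abs hu), hφ.limsup_comp_le_limsup
    (isBoundedUnder_ge_of_abs h).isCoboundedUnder_le (isBoundedUnder_le_of_abs hu)⟩

end Liminf

section LocalDim

variable {ρ : ℝ} (hB2 : 2 < B) (hcB : ∀ k, B ≤ c (k + 1)) (hρ : 0 < ρ)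
  (hr : ∀ k, ρ ≤ r (k + 1) ∧ r (k + 1) ≤ 1 / 2)

include hρ hr

lemma info_mem (k : ℕ) (b : Bool) : info r k b ∈ Icc 0 (-Real.log ρ) := by
  obtain ⟨h1, h2⟩ := hr k
  have : ρ ≤ (if b then 1 - r (k + 1) else r (k + 1)) ∧
      (if b then 1 - r (k + 1) else r (k + 1)) ≤ 1 := by
    split_ifs <;> constructor <;> linarith
  rw [info]
  constructor
  · rw [neg_nonneg]
    exact Real.log_nonpos (hρ.le.trans this.1) this.2
  · exact neg_le_neg (Real.log_le_log hρ this.1)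

lemma logMass_add_le (ω : ℕ → Bool) (n k : ℕ) :
    logMass r (n + k) ω ≤ logMass r n ω + k * -Real.log ρ := by
  induction k with
  | zero => simp
  | succ k ih =>
    rw [← add_assoc, logMass_succ]
    have := (info_mem hρ hr (n + k) (ω (n + k))).2
    push_cast
    linarith

lemma logMass_nonneg (ω : ℕ → Bool) (n : ℕ) : 0 ≤ logMass r n ω :=
  Finset.sum_nonneg fun k _ => (info_mem hρ hr k _).1

include hB2 hcB

lemma ratio_mem (ω : ℕ → Bool) (n : ℕ) :
    logMass r n ω / logScale c n ∈ Icc 0 (-Real.log ρ / Real.log B) := by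
  have hlB : 0 < Real.log B := Real.log_pos (by linarith)
  have hn := logScale_ge hB2 hcB n
  have h0 : 0 ≤ logScale c n := le_trans (by positivity) hn
  have h1 := logMass_nonneg hρ hr ω n
  refine ⟨div_nonneg h1 h0, ?_⟩
  have h2 := logMass_add_le hρ hr ω 0 n
  simp only [zero_add, logMass, Finset.range_zero, Finset.sum_empty] at h2
  have h3 : 0 ≤ -Real.log ρ := (info_mem hρ hr 0 true).1.trans (info_mem hρ hr 0 true).2
  apply div_le_of_le_mul₀ h0 (by positivity)
  calc logMass r n ω ≤ n * -Real.log ρ := h2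
    _ = -Real.log ρ / Real.log B * (n * Real.log B) := by field_simp
    _ ≤ _ := mul_le_mul_of_nonneg_left hn (by positivity)

variable {μ : Measure ℝ} [IsProbabilityMeasure μ]
  (hμ : ∀ w : List Bool, μ (moranI c w) = ENNReal.ofReal (cylMass r w 1 1))
include hμ

lemma measure_moranI_diff (n : ℕ) (ω : ℕ → Bool) :
    μ (moranI c (pref n ω) \
      (moranI c (pref n ω ++ [false]) ∪ moranI c (pref n ω ++ [true]))) = 0 := by
  have hpos := ratio_pos hB2 hcB
  have hup : ∀ b, pref n ω ++ [b] = pref (n + 1) (Function.update ω n b) := by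
    intro b
    rw [pref_succ, Function.update_self]
    congr 1
    rw [pref_congr]
    intro k hk
    rw [Function.update_of_ne hk.ne]
  have hpre : ∀ b, pref n ω = pref n (Function.update ω n b) := by
    intro b
    rw [pref_congr]
    intro k hk
    rw [Function.update_of_ne hk.ne]
  have hsub : ∀ b, moranI c (pref n ω ++ [b]) ⊆ moranI c (pref n ω) := by
    intro b
    rw [hup, hpre b, moranI_pref hpos, moranI_pref hpos]
    exact Icc_subset_Icc (leftPt_mono hB2 hcB _ n.le_succ) (rightPt_anti hB2 hcB _ n.le_succ)
  have hmeas : ∀ w, MeasurableSet (moranI c w) := fun w => measurableSet_Icc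
  have hdisj : Disjoint (moranI c (pref n ω ++ [false])) (moranI c (pref n ω ++ [true])) := by
    rw [Set.disjoint_left]
    intro y hy hy'
    rw [hup, moranI_pref hpos] at hy hy'
    have := eq_of_mem hB2 hcB le_rfl hy hy' n n.lt_succ_self
    simp at this
  have hsum : μ (moranI c (pref n ω ++ [false]) ∪ moranI c (pref n ω ++ [true]))
      = μ (moranI c (pref n ω)) := by
    rw [measure_union hdisj (hmeas _), hμ, hμ, hμ, cylMass_append, cylMass_append]
    simp only [cylMass, length_pref]
    obtain ⟨h1, h2⟩ := hr n
    rw [add_comm 1 n, cylMass_pref (fun k => ⟨by linarith [hr k], by linarith [hr k]⟩),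
      ← ENNReal.ofReal_add]
    · congr 1
      simp
      ring
    · simp only [Bool.false_eq_true, if_false]
      exact mul_nonneg (by linarith) (Real.exp_pos _).le
    · simp only [if_true]
      exact mul_nonneg (by linarith) (Real.exp_pos _).le
  rw [measure_sdiff (union_subset (hsub _) (hsub _)) ((hmeas _).union (hmeas _)).nullMeasurableSet
    (measure_ne_top _ _), hsum, tsub_self]

lemma measure_compl_level (n : ℕ) :
    μ {y | ∃ ω, y ∈ Icc (leftPt c n ω) (leftPt c n ω + scale c n)}ᶜ = 0 := by
  have hpos := ratio_pos hB2 hcB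
  induction n with
  | zero =>
    have h := hμ []
    rw [show ([] : List Bool) = pref 0 (fun _ => false) from rfl, moranI_pref hpos] at h
    simp only [pref, List.range_zero, List.map_nil, cylMass, ENNReal.ofReal_one] at h
    rw [← prob_compl_eq_zero_iff measurableSet_Icc] at h
    exact measure_mono_null (compl_subset_compl.2 fun y hy => ⟨_, hy⟩) h
  | succ n ih =>
    have h2 : μ (⋃ w : {w : List Bool // ∃ ω, w = pref n ω}, (moranI c w \
        (moranI c (w ++ [false]) ∪ moranI c (w ++ [true])))) = 0 := by
      rw [measure_iUnion_null_iff]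
      rintro ⟨w, ω, rfl⟩
      exact measure_moranI_diff hB2 hcB hρ hr hμ n ω
    refine measure_mono_null ?_ (measure_union_null ih h2)
    intro y hy
    by_cases hyn : ∃ ω, y ∈ Icc (leftPt c n ω) (leftPt c n ω + scale c n)
    · right
      obtain ⟨ω, hω⟩ := hyn
      refine mem_iUnion.2 ⟨⟨pref n ω, ω, rfl⟩, ?_, ?_⟩
      · rwa [moranI_pref hpos]
      · intro hmem
        apply hy
        have : ∀ b, y ∈ moranI c (pref n ω ++ [b]) →
            ∃ ω, y ∈ Icc (leftPt c (n + 1) ω) (leftPt c (n + 1) ω + scale c (n + 1)) := by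
          intro b hb
          obtain ⟨ω', hω'⟩ := exists_pref (pref n ω ++ [b])
          rw [List.length_append, length_pref, List.length_singleton] at hω'
          rw [← hω', moranI_pref hpos] at hb
          exact ⟨ω', hb⟩
        rcases hmem with h | h <;> exact this _ h
    · exact Or.inl hyn

omit [IsProbabilityMeasure μ] in
lemma measure_cyl (n : ℕ) (ω : ℕ → Bool) :
    μ (Icc (leftPt c n ω) (leftPt c n ω + scale c n)) =
      ENNReal.ofReal (Real.exp (-logMass r n ω)) := by
  rw [← moranI_pref (ratio_pos hB2 hcB), hμ,
    cylMass_pref (fun k => ⟨by linarith [hr k], by linarith [hr k]⟩)]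

lemma measure_closedBall_ge {n : ℕ} (ω : ℕ → Bool) {δ : ℝ} (hδ : scale c n ≤ δ) :
    Real.exp (-logMass r n ω) ≤ (μ (closedBall (point c ω) δ)).toReal := by
  rw [← ENNReal.ofReal_le_iff_le_toReal (measure_ne_top _ _),
    ← measure_cyl hB2 hcB hρ hr hμ]
  refine measure_mono fun y hy => ?_
  rw [mem_closedBall, Real.dist_eq, abs_le]
  have := point_mem hB2 hcB n ω
  constructor <;> linarith [hy.1, hy.2, this.1, this.2]

lemma measure_closedBall_le {n : ℕ} (ω : ℕ → Bool) {δ : ℝ}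
    (hδ : δ < (1 - 2 / B) * scale c n) :
    (μ (closedBall (point c ω) δ)).toReal ≤ Real.exp (-logMass r (n + 1) ω) := by
  refine ENNReal.toReal_le_of_le_ofReal (Real.exp_pos _).le ?_
  rw [← measure_cyl hB2 hcB hρ hr hμ]
  refine (measure_mono (t := Icc (leftPt c (n + 1) ω) (leftPt c (n + 1) ω + scale c (n + 1)) ∪
    {y | ∃ ω, y ∈ Icc (leftPt c (n + 1) ω) (leftPt c (n + 1) ω + scale c (n + 1))}ᶜ) ?_).trans
    ((measure_union_le _ _).trans ?_)
  · intro y hy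
    by_cases h : ∃ ω, y ∈ Icc (leftPt c (n + 1) ω) (leftPt c (n + 1) ω + scale c (n + 1))
    · left
      obtain ⟨ω', hω'⟩ := h
      have := eq_of_dist_lt hB2 hcB n.lt_succ_self n.lt_succ_self hω'
        (point_mem hB2 hcB (n + 1) ω) (lt_of_le_of_lt (by rwa [← Real.dist_eq]) hδ)
      rw [← moranI_pref (ratio_pos hB2 hcB)] at hω' ⊢
      rwa [← pref_congr.2 fun k hk => this k (Nat.lt_succ_iff.1 hk)]
    · exact Or.inr h
  · rw [measure_compl_level hB2 hcB hρ hr hμ (n + 1), add_zero]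

lemma exists_log_measure_bound : ∃ K, ∀ ω n δ, scale c (n + 1) ≤ δ → δ ≤ scale c n →
    |-Real.log (μ (closedBall (point c ω) δ)).toReal - logMass r (n + 1) ω| ≤ K := by
  have hg := gap_pos hB2
  obtain ⟨j, hj⟩ := pow_unbounded_of_one_lt (1 / (1 - 2 / B)) (one_lt_two (α := ℝ))
  rw [div_lt_iff₀ hg] at hj
  have hC : 0 ≤ -Real.log ρ := (info_mem hρ hr 0 true).1.trans (info_mem hρ hr 0 true).2
  refine ⟨(j + 1 : ℕ) * -Real.log ρ, fun ω n δ h1 h2 => ?_⟩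
  have hge := measure_closedBall_ge hB2 hcB hρ hr hμ ω h1
  have hpos : 0 < (μ (closedBall (point c ω) δ)).toReal := (Real.exp_pos _).trans_le hge
  have hup : -Real.log (μ (closedBall (point c ω) δ)).toReal ≤ logMass r (n + 1) ω := by
    have := Real.log_le_log (Real.exp_pos _) hge
    rw [Real.log_exp] at this
    linarith
  have hlow : logMass r (n + 1) ω - (j + 1 : ℕ) * -Real.log ρ ≤
      -Real.log (μ (closedBall (point c ω) δ)).toReal := by
    rcases le_or_gt j n with hjn | hjn
    · obtain ⟨m, rfl⟩ := Nat.exists_eq_add_of_le' hjn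
      have hs := scale_add_le hB2 hcB m j
      have hlt : δ < (1 - 2 / B) * scale c m := by
        have h3 := scale_pos c (m + j)
        nlinarith
      have := Real.log_le_log hpos (measure_closedBall_le hB2 hcB hρ hr hμ ω hlt)
      rw [Real.log_exp] at this
      have h4 := logMass_add_le hρ hr ω (m + 1) j
      rw [show m + 1 + j = m + j + 1 by ring] at h4
      push_cast
      linarith
    · have h4 := logMass_add_le hρ hr ω 0 (n + 1)
      have h5 : ((n + 1 : ℕ) : ℝ) * -Real.log ρ ≤ (j + 1 : ℕ) * -Real.log ρ :=
        mul_le_mul_of_nonneg_right (by exact_mod_cast (by omega)) hC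
      have h6 : Real.log (μ (closedBall (point c ω) δ)).toReal ≤ 0 :=
        Real.log_nonpos hpos.le (ENNReal.toReal_le_of_le_ofReal zero_le_one
          (by simpa using prob_le_one))
      have h7 : logMass r 0 ω = 0 := by simp [logMass]
      rw [zero_add] at h4
      linarith
  rw [abs_le]
  constructor <;> linarith [mul_nonneg (Nat.cast_nonneg (α := ℝ) (j + 1)) hC]

lemma exists_localDim_bound (hcA : ∀ k, c (k + 1) ≤ A) :
    ∃ K, ∀ ω n δ, scale c (n + 1) ≤ δ → δ ≤ scale c n → δ < 1 →
    |Real.log (μ (closedBall (point c ω) δ)).toReal / Real.log δ -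
      logMass r (n + 1) ω / logScale c (n + 1)| ≤ K / -Real.log δ := by
  obtain ⟨K, hK⟩ := exists_log_measure_bound hB2 hcB hρ hr hμ
  refine ⟨K + -Real.log ρ / Real.log B * Real.log A, fun ω n δ h1 h2 h3 => ?_⟩
  have hδ : 0 < δ := (scale_pos c _).trans_le h1
  have hlog : 0 < -Real.log δ := neg_pos.2 (Real.log_neg hδ h3)
  have hK' := hK ω n δ h1 h2
  obtain ⟨hq0, hq1⟩ := ratio_mem hB2 hcB hρ hr ω (n + 1)
  have hl1 : -Real.log δ ≤ logScale c (n + 1) := by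
    have := Real.log_le_log (scale_pos c (n + 1)) h1
    rw [scale, Real.log_exp] at this
    linarith
  have hl2 : logScale c n ≤ -Real.log δ := by
    have := Real.log_le_log hδ h2
    rw [scale, Real.log_exp] at this
    linarith
  have hl3 : logScale c (n + 1) ≤ logScale c n + Real.log A := by
    rw [logScale_succ]
    linarith [Real.log_le_log (ratio_pos hB2 hcB n) (hcA n)]
  set Λ := logScale c (n + 1) with hΛ
  set S := logMass r (n + 1) ω with hS
  set m := Real.log (μ (closedBall (point c ω) δ)).toReal with hm
  have hΛ0 : 0 < Λ := hlog.trans_le hl1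
  rw [show m / Real.log δ - S / Λ =
    ((-m - S) + (S / Λ) * (Λ - -Real.log δ)) / -Real.log δ by
      have : Real.log δ ≠ 0 := by linarith
      field_simp
      ring, abs_div, abs_of_pos hlog]
  refine div_le_div_of_nonneg_right ?_ hlog.le
  refine (abs_add_le _ _).trans (add_le_add hK' ?_)
  rw [abs_mul, abs_of_nonneg hq0, abs_of_nonneg (by linarith)]
  exact mul_le_mul hq1 (by linarith) (by linarith) (hq0.trans hq1)

/-- The lower and upper local dimensions can be computed along the basic intervals. -/
theorem localDim_point (hcA : ∀ k, c (k + 1) ≤ A) (ω : ℕ → Bool) :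
    lowerLocalDim μ (point c ω) = liminf (fun n => logMass r n ω / logScale c n) atTop ∧
    upperLocalDim μ (point c ω) = limsup (fun n => logMass r n ω / logScale c n) atTop := by
  obtain ⟨K, hK⟩ := exists_localDim_bound hB2 hcB hρ hr hμ hcA
  set d : ℕ → ℝ := fun n => logMass r n ω / logScale c n with hd
  set F : ℝ → ℝ := fun δ => Real.log (μ (closedBall (point c ω) δ)).toReal / Real.log δ with hF
  set D := -Real.log ρ / Real.log B with hD
  have hdb : ∀ n, |d n| ≤ D + 1 := fun n => by
    obtain ⟨h1, h2⟩ := ratio_mem hB2 hcB hρ hr ω n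
    rw [abs_of_nonneg h1]; linarith
  have hsc1 : ∀ n, scale c (n + 1) < 1 := fun n =>
    (scale_le_pow hB2 hcB (n + 1)).trans_lt (pow_lt_one₀ (by norm_num) (by norm_num) (by simp))
  have hch : ∀ δ : ℝ, ∃ n, (0 < δ → δ < 1 → scale c (n + 1) ≤ δ ∧ δ ≤ scale c n) := by
    intro δ
    by_cases h : 0 < δ ∧ δ < 1
    · obtain ⟨h0, h1⟩ := h
      have hex : ∃ n, scale c n ≤ δ :=
        (((tendsto_scale hB2 hcB).eventually (gt_mem_nhds h0)).exists).imp fun _ h => h.le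
      classical
      have hspec := Nat.find_spec hex
      have hne : Nat.find hex ≠ 0 := by
        intro h
        rw [h, scale_zero] at hspec
        linarith
      obtain ⟨n, hn⟩ := Nat.exists_eq_succ_of_ne_zero hne
      refine ⟨n, fun _ _ => ⟨by rwa [hn] at hspec, ?_⟩⟩
      exact (not_le.1 (Nat.find_min hex (m := n) (by omega))).le
    · exact ⟨0, fun h0 h1 => absurd ⟨h0, h1⟩ h⟩
  choose nn hnn using hch
  have hsmall : ∀ᶠ δ : ℝ in 𝓝[>] 0, 0 < δ ∧ δ < 1 := by
    filter_upwards [Ioo_mem_nhdsGT (zero_lt_one (α := ℝ))] with δ h using h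
  have hnnt : Tendsto nn (𝓝[>] 0) atTop := by
    rw [Filter.tendsto_atTop]
    intro m
    filter_upwards [hsmall, Ioo_mem_nhdsGT (scale_pos c m)] with δ hδ hδ'
    by_contra hlt
    have := scale_antitone hB2 hcB (show nn δ + 1 ≤ m by omega)
    linarith [(hnn δ hδ.1 hδ.2).1, hδ'.2]
  have hlog : Tendsto (fun δ : ℝ => K / -Real.log δ) (𝓝[>] 0) (𝓝 0) :=
    (tendsto_neg_atBot_atTop.comp Real.tendsto_log_nhdsGT_zero).const_div_atTop K
  have hsc : Tendsto (fun n => scale c (n + 1)) atTop (𝓝[>] 0) :=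
    tendsto_nhdsWithin_iff.2 ⟨(tendsto_scale hB2 hcB).comp (tendsto_add_atTop_nat 1),
      Eventually.of_forall fun n => scale_pos c _⟩
  have hFd : Tendsto (fun δ => F δ - d (nn δ + 1)) (𝓝[>] 0) (𝓝 0) := by
    refine squeeze_zero_norm' ?_ hlog
    filter_upwards [hsmall] with δ hδ
    exact hK ω _ δ (hnn δ hδ.1 hδ.2).1 (hnn δ hδ.1 hδ.2).2 hδ.2
  have hFs : Tendsto (fun n => F (scale c (n + 1)) - d (n + 1)) atTop (𝓝 0) := by
    refine squeeze_zero_norm (fun n => ?_) (hlog.comp hsc)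
    exact hK ω n _ le_rfl (scale_antitone hB2 hcB n.le_succ) (hsc1 n)
  have hFb : ∀ᶠ δ in 𝓝[>] 0, |F δ| ≤ D + 2 := by
    filter_upwards [hFd.eventually (Metric.ball_mem_nhds 0 one_pos)] with δ hδ
    rw [Real.dist_eq, sub_zero] at hδ
    have := abs_add_le (F δ - d (nn δ + 1)) (d (nn δ + 1))
    rw [sub_add_cancel] at this
    linarith [hdb (nn δ + 1)]
  have hdb' : ∀ n, |d n| ≤ D + 2 := fun n => by linarith [hdb n]
  have hFsb : ∀ᶠ n in atTop, |F (scale c (n + 1))| ≤ D + 2 := hsc.eventually hFb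
  have hnn1 : Tendsto (fun δ => nn δ + 1) (𝓝[>] 0) atTop :=
    (tendsto_add_atTop_nat 1).comp hnnt
  have e1 := liminf_eq_of_sub hFb (Eventually.of_forall fun δ => hdb' (nn δ + 1)) hFd
  have e2 := liminf_eq_of_sub hFsb (Eventually.of_forall fun n => hdb' (n + 1)) hFs
  have e3 := limsup_eq_of_sub hFb (Eventually.of_forall fun δ => hdb' (nn δ + 1)) hFd
  have e4 := limsup_eq_of_sub hFsb (Eventually.of_forall fun n => hdb' (n + 1)) hFs
  have hdbe : ∀ᶠ n in atTop, |d n| ≤ D + 2 := Eventually.of_forall hdb'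
  rw [liminf_nat_add d 1] at e2
  rw [limsup_nat_add d 1] at e4
  have f1 := comp_bounds hsc hFb
  have f2 := comp_bounds hnn1 hdbe
  rw [← e1, ← e3] at f2
  rw [e2, e4] at f1
  exact ⟨le_antisymm f1.1 f2.1, le_antisymm f2.2 f1.2⟩

end LocalDim

end

section

variable {A B : ℝ} {c r : ℕ → ℝ}

section Beta

variable {ρ C : ℝ}

lemma partition_pos (h0 : 0 < ρ) (h1 : ρ < 1) (s : ℝ) : 0 < ρ ^ s + (1 - ρ) ^ s :=
  add_pos (Real.rpow_pos_of_pos h0 s) (Real.rpow_pos_of_pos (by linarith) s)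

lemma hasDerivAt_betaFn (h0 : 0 < ρ) (h1 : ρ < 1) (s : ℝ) :
    HasDerivAt (betaFn ρ C) (-((ρ ^ s * Real.log ρ + (1 - ρ) ^ s * Real.log (1 - ρ)) /
      (ρ ^ s + (1 - ρ) ^ s)) / Real.log C) s := by
  have hd := ((Real.hasStrictDerivAt_const_rpow h0 s).hasDerivAt).add
    ((Real.hasStrictDerivAt_const_rpow (show 0 < 1 - ρ by linarith) s).hasDerivAt)
  exact ((hd.log (partition_pos h0 h1 s).ne').neg).div_const _

/-- The graph of `betaFn` lies below its tangent lines. -/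
lemma betaFn_le_tangent (h0 : 0 < ρ) (h1 : ρ < 1) (hC : 1 < C) (s s₀ : ℝ) :
    betaFn ρ C s ≤ betaFn ρ C s₀ + deriv (betaFn ρ C) s₀ * (s - s₀) := by
  have hlC := Real.log_pos hC
  have hZ0 := partition_pos h0 h1 s₀
  have hZ := partition_pos h0 h1 s
  have h1' : 0 < 1 - ρ := by linarith
  rw [(hasDerivAt_betaFn h0 h1 s₀).deriv, betaFn, betaFn]
  set Z := ρ ^ s₀ + (1 - ρ) ^ s₀ with hZdef
  set Z' := ρ ^ s + (1 - ρ) ^ s with hZ'def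
  have hx : 0 < ρ ^ s₀ := Real.rpow_pos_of_pos h0 _
  have hy : 0 < (1 - ρ) ^ s₀ := Real.rpow_pos_of_pos h1' _
  have hconc := strictConcaveOn_log_Ioi.concaveOn.2
    (show ρ ^ (s - s₀) ∈ Ioi (0 : ℝ) from Real.rpow_pos_of_pos h0 _)
    (show (1 - ρ) ^ (s - s₀) ∈ Ioi (0 : ℝ) from Real.rpow_pos_of_pos h1' _)
    (show 0 ≤ ρ ^ s₀ / Z by positivity) (show 0 ≤ (1 - ρ) ^ s₀ / Z by positivity)
    (by rw [← add_div]; exact div_self hZ0.ne')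
  simp only [smul_eq_mul] at hconc
  have e : ρ ^ s₀ / Z * ρ ^ (s - s₀) + (1 - ρ) ^ s₀ / Z * (1 - ρ) ^ (s - s₀) = Z' / Z := by
    rw [div_mul_eq_mul_div, div_mul_eq_mul_div, ← Real.rpow_add h0, ← Real.rpow_add h1',
      ← add_div]
    simp [hZ'def]
  rw [e, Real.log_div hZ.ne' hZ0.ne', Real.log_rpow h0, Real.log_rpow h1'] at hconc
  rw [div_mul_eq_mul_div, ← add_div]
  refine div_le_div_of_nonneg_right ?_ hlC.le
  have e2 : ρ ^ s₀ / Z * ((s - s₀) * Real.log ρ) + (1 - ρ) ^ s₀ / Z * ((s - s₀) * Real.log (1 - ρ))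
    = (ρ ^ s₀ * Real.log ρ + (1 - ρ) ^ s₀ * Real.log (1 - ρ)) / Z * (s - s₀) := by ring
  rw [e2] at hconc
  linarith

end Beta

section Covering

variable (hB2 : 2 < B) (hcB : ∀ k, B ≤ c (k + 1))
include hB2 hcB

lemma dimH_le_of_cover {t θ : ℝ} (ht : 0 < t) (hθ0 : 0 ≤ θ) (hθ1 : θ < 1) {E : Set ℝ}
    (G : ∀ n : ℕ, Finset (Fin n → Bool))
    (hE : ∀ x ∈ E, ∃ ω, point c ω = x ∧ ∃ᶠ n in atTop, (fun i : Fin n => ω i) ∈ G n)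
    (hG : ∀ᶠ n in atTop, (G n).card * scale c n ^ t ≤ θ ^ n) :
    dimH E ≤ ENNReal.ofReal t := by
  classical
  let ext : ∀ n, (Fin n → Bool) → ℕ → Bool := fun n w k => if h : k < n then w ⟨k, h⟩ else false
  let J : ∀ n, (Fin n → Bool) → Set ℝ := fun n w =>
    Icc (leftPt c n (ext n w)) (leftPt c n (ext n w) + scale c n)
  have hJ : ∀ n (ω : ℕ → Bool), point c ω ∈ J n fun i => ω i := by
    intro n ω
    have : leftPt c n (ext n fun i => ω i) = leftPt c n ω := by
      apply Finset.sum_congr rfl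
      intro k hk
      simp [ext, Finset.mem_range.1 hk]
    simp only [J, this]
    exact point_mem hB2 hcB n ω
  have hJd : ∀ n w, ediam (J n w) = ENNReal.ofReal (scale c n) := by
    intro n w
    simp [J, Real.ediam_Icc]
  let U : ℕ → (Σ n, Fin n → Bool) → Set ℝ := fun m w =>
    if m ≤ w.1 ∧ w.2 ∈ G w.1 then J w.1 w.2 else ∅
  have hfin : ∑' n : ℕ, ENNReal.ofReal (θ ^ n) ≠ ⊤ :=
    (summable_geometric_of_lt_one hθ0 hθ1).tsum_ofReal_ne_top
  have key : μH[t] E ≤ ∑' n : ℕ, ENNReal.ofReal (θ ^ n) := by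
    refine (Measure.hausdorffMeasure_le_liminf_tsum (l := atTop) t E
      (fun m => ENNReal.ofReal (scale c m)) ?_ U ?_ ?_).trans ?_
    · rw [← ENNReal.ofReal_zero]
      exact ENNReal.tendsto_ofReal (tendsto_scale hB2 hcB)
    · refine Eventually.of_forall fun m w => ?_
      simp only [U]
      split_ifs with h
      · rw [hJd]
        exact ENNReal.ofReal_le_ofReal (scale_antitone hB2 hcB h.1)
      · simp
    · refine Eventually.of_forall fun m x hx => ?_
      obtain ⟨ω, rfl, hω⟩ := hE x hx
      obtain ⟨n, hn, hmem⟩ := (frequently_atTop.1 hω) m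
      refine mem_iUnion.2 ⟨⟨n, fun i => ω i⟩, ?_⟩
      simp only [U]
      rw [if_pos ⟨hn, hmem⟩]
      exact hJ n ω
    · refine liminf_le_of_frequently_le' (Eventually.frequently ?_)
      obtain ⟨m₀, hm₀⟩ := eventually_atTop.1 hG
      filter_upwards [eventually_ge_atTop m₀] with m hm
      rw [ENNReal.tsum_sigma']
      refine ENNReal.tsum_le_tsum fun n => ?_
      rw [tsum_fintype]
      by_cases hmn : m ≤ n
      · have : ∀ w : Fin n → Bool, ediam (U m ⟨n, w⟩) ^ t =
            if w ∈ G n then ENNReal.ofReal (scale c n ^ t) else 0 := by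
          intro w
          simp only [U, hmn, true_and]
          split_ifs
          · rw [hJd, ENNReal.ofReal_rpow_of_pos (scale_pos c n)]
          · simp [ht]
        simp only [this]
        rw [Finset.sum_ite_mem, Finset.univ_inter, Finset.sum_const, nsmul_eq_mul,
          ← ENNReal.ofReal_natCast, ← ENNReal.ofReal_mul (Nat.cast_nonneg _)]
        exact ENNReal.ofReal_le_ofReal (hm₀ n (hm.trans hmn))
      · have : ∀ w : Fin n → Bool, ediam (U m ⟨n, w⟩) ^ t = 0 := by
          intro w
          simp [U, hmn, ht]
        simp [this]
  have := dimH_le_of_hausdorffMeasure_ne_top (s := E) (d := t.toNNReal)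
    (by rw [Real.coe_toNNReal _ ht.le]; exact ne_top_of_le_ne_top hfin key)
  exact this

end Covering

section Counting

lemma card_le_exp (hc : ∀ k, 1 < c (k + 1)) (hr : ∀ k, 0 < r (k + 1) ∧ r (k + 1) < 1) {n : ℕ}
    (x : ℕ → ℝ) (G : Finset (Fin n → Bool)) {K : ℝ}
    (hG : ∀ w ∈ G, ∑ i : Fin n, x i * info r i (w i) ≤ K) :
    (G.card : ℝ) ≤ Real.exp (K - ∑ k ∈ Finset.range n,
      betaFn (r (k + 1)) (c (k + 1)) (x k) * Real.log (c (k + 1))) := by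
  have hZ : ∀ k, ∑ b : Bool, Real.exp (-(x k * info r k b)) =
      Real.exp (-(betaFn (r (k + 1)) (c (k + 1)) (x k) * Real.log (c (k + 1)))) := by
    intro k
    obtain ⟨h0, h1⟩ := hr k
    rw [betaFn, div_mul_cancel₀ _ (Real.log_pos (hc k)).ne', neg_neg,
      Real.exp_log (partition_pos h0 h1 _), Real.rpow_def_of_pos h0,
      Real.rpow_def_of_pos (show 0 < 1 - r (k + 1) by linarith)]
    simp [info, mul_comm, add_comm]
  have hprod : ∑ w : Fin n → Bool, Real.exp (-∑ i : Fin n, x i * info r i (w i)) =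
      Real.exp (-∑ k ∈ Finset.range n,
        betaFn (r (k + 1)) (c (k + 1)) (x k) * Real.log (c (k + 1))) := by
    rw [← Finset.sum_neg_distrib, Real.exp_sum]
    simp only [← Finset.sum_neg_distrib, Real.exp_sum]
    rw [Finset.prod_range]
    simp only [← hZ]
    rw [Finset.prod_univ_sum, Fintype.piFinset_univ]
  calc (G.card : ℝ) = ∑ w ∈ G, 1 := by simp
    _ ≤ ∑ w ∈ G, Real.exp (K - ∑ i : Fin n, x i * info r i (w i)) :=
        Finset.sum_le_sum fun w hw => Real.one_le_exp (by linarith [hG w hw])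
    _ ≤ ∑ w : Fin n → Bool, Real.exp (K - ∑ i : Fin n, x i * info r i (w i)) :=
        Finset.sum_le_sum_of_subset_of_nonneg (Finset.subset_univ _)
          fun _ _ _ => (Real.exp_pos _).le
    _ = _ := by
        simp only [sub_eq_add_neg, Real.exp_add]
        rw [← Finset.mul_sum, hprod]

end Counting

end

section

variable {A B p q : ℝ} {N : ℕ → ℕ} {c r : ℕ → ℝ}

/-- Sums of sequences which agree after step `m` differ by a multiple of `m`. -/
lemma abs_sum_sub_sum_le {f g : ℕ → ℝ} {C : ℝ} (hC : ∀ k, |f k - g k| ≤ C) {m n : ℕ}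
    (hfg : ∀ k, m ≤ k → k < n → f k = g k) :
    |∑ k ∈ Finset.range n, f k - ∑ k ∈ Finset.range n, g k| ≤ C * m := by
  have hC0 : 0 ≤ C := (abs_nonneg _).trans (hC 0)
  have key : ∀ n, (∀ k, m ≤ k → k < n → f k = g k) →
      |∑ k ∈ Finset.range n, f k - ∑ k ∈ Finset.range n, g k| ≤ C * (min m n : ℕ) := by
    intro n
    induction n with
    | zero => simp
    | succ n ih =>
      intro h
      have ih' := ih fun k hk hkn => h k hk (by omega)
      rw [Finset.sum_range_succ, Finset.sum_range_succ]
      rcases lt_or_ge n m with hnm | hnm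
      · rw [min_eq_right (by omega)] at ih' ⊢
        have h1 := hC n
        push_cast
        have : ∑ k ∈ Finset.range n, f k + f n - (∑ k ∈ Finset.range n, g k + g n) =
          (∑ k ∈ Finset.range n, f k - ∑ k ∈ Finset.range n, g k) + (f n - g n) := by ring
        rw [this]
        refine (abs_add_le _ _).trans ?_
        linarith
      · rw [min_eq_left (by omega)] at ih' ⊢
        rw [h n hnm (by omega)]
        simpa using ih'
  refine (key n hfg).trans (mul_le_mul_of_nonneg_left ?_ hC0)
  exact_mod_cast min_le_left m n

/-- The standing assumptions on a Moran construction which uses the ratio `A` and the weight `p`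
on the blocks of even index, and the ratio `B` and the weight `q` on the blocks of odd index. -/
structure IsAlternating (A B p q : ℝ) (N : ℕ → ℕ) (c r : ℕ → ℝ) : Prop where
  lt : B < A
  two_lt : 2 < B
  p_pos : 0 < p
  p_le : p ≤ 1 / 2
  q_pos : 0 < q
  q_le : q ≤ 1 / 2
  zero : N 0 = 0
  mono : StrictMono N
  lim : Tendsto (fun i : ℕ => (N (i + 1) : ℝ) / (N i : ℝ)) atTop atTop
  stepA : ∀ i k, N (2 * i) ≤ k → k < N (2 * i + 1) → c (k + 1) = A ∧ r (k + 1) = p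
  stepB : ∀ i k, N (2 * i + 1) ≤ k → k < N (2 * i + 2) → c (k + 1) = B ∧ r (k + 1) = q

namespace IsAlternating

variable (D : IsAlternating A B p q N c r)
include D

lemma exists_block (k : ℕ) : ∃ j, N j ≤ k ∧ k < N (j + 1) := by
  have hex : ∃ j, k < N j := ⟨k + 1, D.mono.id_le (k + 1)⟩
  classical
  have hpos : Nat.find hex ≠ 0 := by
    intro h
    have := Nat.find_spec hex
    rw [h, D.zero] at this
    omega
  obtain ⟨j, hj⟩ := Nat.exists_eq_succ_of_ne_zero hpos
  refine ⟨j, not_lt.1 (Nat.find_min hex (by omega)), ?_⟩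
  have := Nat.find_spec hex
  rwa [hj] at this

lemma block_cases (k : ℕ) : ∃ i, (N (2 * i) ≤ k ∧ k < N (2 * i + 1)) ∨
    (N (2 * i + 1) ≤ k ∧ k < N (2 * i + 2)) := by
  obtain ⟨j, h1, h2⟩ := D.exists_block k
  rcases Nat.even_or_odd' j with ⟨i, rfl | rfl⟩
  · exact ⟨i, Or.inl ⟨h1, h2⟩⟩
  · exact ⟨i, Or.inr ⟨h1, h2⟩⟩

lemma step (k : ℕ) : (c (k + 1) = A ∧ r (k + 1) = p) ∨ (c (k + 1) = B ∧ r (k + 1) = q) := by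
  obtain ⟨i, h | h⟩ := D.block_cases k
  · exact Or.inl (D.stepA i k h.1 h.2)
  · exact Or.inr (D.stepB i k h.1 h.2)

lemma B_le (k : ℕ) : B ≤ c (k + 1) := by
  rcases D.step k with h | h <;> rw [h.1]
  exact D.lt.le

lemma le_A (k : ℕ) : c (k + 1) ≤ A := by
  rcases D.step k with h | h <;> rw [h.1]
  exact D.lt.le

lemma min_pos : 0 < min p q := lt_min D.p_pos D.q_pos

lemma r_mem (k : ℕ) : min p q ≤ r (k + 1) ∧ r (k + 1) ≤ 1 / 2 := by
  rcases D.step k with h | h <;> rw [h.2]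
  · exact ⟨min_le_left _ _, D.p_le⟩
  · exact ⟨min_le_right _ _, D.q_le⟩

lemma r_pos_lt (k : ℕ) : 0 < r (k + 1) ∧ r (k + 1) < 1 :=
  ⟨D.min_pos.trans_le (D.r_mem k).1, (D.r_mem k).2.trans_lt (by norm_num)⟩

lemma one_lt_c (k : ℕ) : 1 < c (k + 1) := by linarith [D.B_le k, D.two_lt]

lemma log_B_pos : 0 < Real.log B := Real.log_pos (by linarith [D.two_lt])

lemma log_lt : Real.log B < Real.log A :=
  Real.log_lt_log (by linarith [D.two_lt]) D.lt

lemma log_A_pos : 0 < Real.log A := D.log_B_pos.trans D.log_lt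

lemma log_c_mem (k : ℕ) : Real.log (c (k + 1)) ∈ Icc (Real.log B) (Real.log A) :=
  ⟨Real.log_le_log (by linarith [D.two_lt]) (D.B_le k),
    Real.log_le_log (by linarith [D.one_lt_c k]) (D.le_A k)⟩

lemma tendsto_N : Tendsto N atTop atTop := D.mono.tendsto_atTop

lemma eventually_le_mul {ε : ℝ} (hε : 0 < ε) : ∀ᶠ j in atTop, (N j : ℝ) ≤ ε * N (j + 1) := by
  filter_upwards [D.lim.eventually_ge_atTop (1 / ε), D.tendsto_N.eventually_gt_atTop 0]
    with j h1 h2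
  have h3 : (0 : ℝ) < N j := by exact_mod_cast h2
  rw [div_le_div_iff₀ hε h3] at h1
  linarith

lemma eventually_forall_block {P : ℕ → Prop} (h : ∀ᶠ j in atTop, P j) :
    ∀ᶠ n in atTop, ∀ j, n ≤ N (j + 1) → P j := by
  obtain ⟨j₀, hj₀⟩ := eventually_atTop.1 h
  filter_upwards [eventually_gt_atTop (N j₀)] with n hn j hj
  apply hj₀
  have := D.mono.lt_iff_lt.1 (hn.trans_le hj)
  omega

/-- The length at the end of a block with ratio `A` is governed by that block. -/
lemma abs_logScale_sub_le (i n : ℕ) (hn : n ≤ N (2 * i + 1)) :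
    |logScale c n - n * Real.log A| ≤ Real.log A * N (2 * i) := by
  have := abs_sum_sub_sum_le (f := fun k => Real.log (c (k + 1))) (g := fun _ => Real.log A)
    (C := Real.log A) (m := N (2 * i)) (n := n) ?_ ?_
  · simpa [logScale] using this
  · intro k
    have := D.log_c_mem k
    rw [abs_le]
    constructor <;> linarith [this.1, this.2, D.log_B_pos, D.log_A_pos]
  · intro k h1 h2
    rw [(D.stepA i k h1 (by omega)).1]

lemma dimH_moranSet_le : dimH (moranSet c) ≤ ENNReal.ofReal (Real.log 2 / Real.log A) := by
  classical
  have hlA := D.log_A_pos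
  have hl2 : 0 < Real.log 2 := Real.log_pos (by norm_num)
  refine le_of_forall_gt_imp_ge_of_dense fun a ha => ?_
  rcases eq_or_ne a ⊤ with rfl | hatop
  · exact le_top
  obtain ⟨t, rfl⟩ : ∃ t : ℝ, a = ENNReal.ofReal t := ⟨a.toReal, (ENNReal.ofReal_toReal hatop).symm⟩
  have ht : Real.log 2 / Real.log A < t := (ENNReal.ofReal_lt_ofReal_iff_of_nonneg (by positivity)).1 ha
  have ht0 : 0 < t := lt_trans (by positivity) ht
  rw [div_lt_iff₀ hlA] at ht
  set η := (t * Real.log A - Real.log 2) / 2 with hη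
  have hη0 : 0 < η := by linarith
  refine dimH_le_of_cover D.two_lt D.B_le ht0 (Real.exp_pos (-η)).le (Real.exp_lt_one_iff.2 (by linarith))
    (fun n => if ∃ i, n = N (2 * i + 1) then Finset.univ else ∅) ?_ ?_
  · intro x hx
    obtain ⟨ω, hω⟩ := (mem_moranSet_iff D.two_lt D.B_le).1 hx
    refine ⟨ω, hω, ?_⟩
    rw [frequently_atTop]
    intro m
    refine ⟨N (2 * m + 1), ?_, ?_⟩
    · have := D.mono.id_le (2 * m + 1)
      simp only [id] at this
      omega
    · rw [if_pos ⟨m, rfl⟩]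
      exact Finset.mem_univ _
  · have hε : 0 < η / (t * Real.log A) := by positivity
    filter_upwards [D.eventually_forall_block (D.eventually_le_mul hε)] with n hn
    split_ifs with h
    · obtain ⟨i, rfl⟩ := h
      have h1 := hn (2 * i) le_rfl
      have h2 := (abs_le.1 (D.abs_logScale_sub_le i _ le_rfl)).1
      rw [div_mul_eq_mul_div, le_div_iff₀ (by positivity)] at h1
      set n := N (2 * i + 1)
      have h3 : ((Finset.univ : Finset (Fin n → Bool)).card : ℝ) = Real.exp (n * Real.log 2) := by
        rw [Finset.card_univ, Fintype.card_fun, Fintype.card_bool, Fintype.card_fin, mul_comm,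
          ← Real.rpow_def_of_pos (by norm_num)]
        simp
      rw [h3, scale, ← Real.exp_mul, ← Real.exp_add, ← Real.exp_nat_mul, Real.exp_le_exp]
      nlinarith
    · simp only [Finset.card_empty, Nat.cast_zero, zero_mul]
      positivity

end IsAlternating

end

section

variable {A B p q : ℝ} {N : ℕ → ℕ} {c r : ℕ → ℝ}

namespace IsAlternating

variable (D : IsAlternating A B p q N c r)
include D

lemma logScale_pos {n : ℕ} (hn : 0 < n) : 0 < logScale c n :=
  lt_of_lt_of_le (mul_pos (by exact_mod_cast hn) D.log_B_pos) (logScale_ge D.two_lt D.B_le n)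

/-- Along a block with ratio `B`, the information grows at least at the minimal rate. -/
lemma logMass_sub_ge {i n : ℕ} (h1 : N (2 * i + 1) ≤ n) (h2 : n ≤ N (2 * i + 2)) (ω : ℕ → Bool) :
    -Real.log (1 - q) / Real.log B * (logScale c n - logScale c (N (2 * i + 1))) ≤
      logMass r n ω - logMass r (N (2 * i + 1)) ω := by
  have e1 := Finset.sum_range_add_sum_Ico (fun k => Real.log (c (k + 1))) h1
  have e2 := Finset.sum_range_add_sum_Ico (fun k => info r k (ω k)) h1
  rw [logScale, logScale, logMass, logMass, ← e1, ← e2, add_sub_cancel_left, add_sub_cancel_left,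
    Finset.mul_sum]
  refine Finset.sum_le_sum fun k hk => ?_
  rw [Finset.mem_Ico] at hk
  obtain ⟨hc, hr⟩ := D.stepB i k hk.1 (by omega)
  rw [hc, div_mul_cancel₀ _ D.log_B_pos.ne', info, hr]
  have := D.q_pos
  have := D.q_le
  refine neg_le_neg (Real.log_le_log ?_ ?_) <;> split_ifs <;> linarith

lemma sum_betaFn_ge (σ s : ℝ) {i n : ℕ} (h1 : N (2 * i) ≤ n) (h2 : n ≤ N (2 * i + 1)) :
    betaFn q B σ * logScale c (N (2 * i)) +
      betaFn p A s * (logScale c n - logScale c (N (2 * i))) -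
      |betaFn p A σ - betaFn q B σ| * Real.log A * N (2 * i - 1) ≤
    ∑ k ∈ Finset.range n, betaFn (r (k + 1)) (c (k + 1)) (if k < N (2 * i) then σ else s) *
      Real.log (c (k + 1)) := by
  have e1 := Finset.sum_range_add_sum_Ico (fun k => Real.log (c (k + 1))) h1
  rw [← Finset.sum_range_add_sum_Ico _ h1, logScale, logScale, ← e1, add_sub_cancel_left]
  have hA : ∑ k ∈ Finset.Ico (N (2 * i)) n, betaFn (r (k + 1)) (c (k + 1))
      (if k < N (2 * i) then σ else s) * Real.log (c (k + 1)) =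
      betaFn p A s * ∑ k ∈ Finset.Ico (N (2 * i)) n, Real.log (c (k + 1)) := by
    rw [Finset.mul_sum]
    refine Finset.sum_congr rfl fun k hk => ?_
    rw [Finset.mem_Ico] at hk
    obtain ⟨hc, hr⟩ := D.stepA i k hk.1 (by omega)
    rw [if_neg (by omega), hc, hr]
  have hB := abs_sum_sub_sum_le
    (f := fun k => betaFn (r (k + 1)) (c (k + 1)) σ * Real.log (c (k + 1)))
    (g := fun k => betaFn q B σ * Real.log (c (k + 1)))
    (C := |betaFn p A σ - betaFn q B σ| * Real.log A) (m := N (2 * i - 1)) (n := N (2 * i)) ?_ ?_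
  · rw [hA]
    have hB' : ∑ k ∈ Finset.range (N (2 * i)), betaFn (r (k + 1)) (c (k + 1))
        (if k < N (2 * i) then σ else s) * Real.log (c (k + 1)) =
        ∑ k ∈ Finset.range (N (2 * i)), betaFn (r (k + 1)) (c (k + 1)) σ *
          Real.log (c (k + 1)) :=
      Finset.sum_congr rfl fun k hk => by rw [if_pos (Finset.mem_range.1 hk)]
    rw [hB']
    rw [← Finset.mul_sum] at hB
    linarith [(abs_le.1 hB).1]
  · intro k
    rcases D.step k with h | h
    · rw [h.1, h.2, ← sub_mul, abs_mul, abs_of_pos D.log_A_pos]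
    · rw [h.1, h.2, sub_self, abs_zero]
      have := D.log_A_pos
      positivity
  · intro k hk1 hk2
    rcases i with _ | i
    · simp [D.zero] at hk2
    · obtain ⟨hc, hr⟩ := D.stepB i k hk1 hk2
      simp only [hc, hr]

variable {μ : Measure ℝ} [IsProbabilityMeasure μ]

lemma dimH_level_le (hμ : ∀ w : List Bool, μ (moranI c w) = ENNReal.ofReal (cylMass r w 1 1))
    {α α' s σ δ t : ℝ} (hs0 : 0 ≤ s) (hsσ : s ≤ σ) (hα : α < -Real.log (1 - q) / Real.log B)
    (hδ : 0 < δ) (hσ : σ * α' - betaFn q B σ ≤ s * α' - betaFn p A s + δ) (ht0 : 0 < t)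
    (ht : s * α - betaFn p A s + 5 * δ ≤ t) :
    dimH {x | x ∈ moranSet c ∧ lowerLocalDim μ x = α ∧ upperLocalDim μ x = α'} ≤
      ENNReal.ofReal t := by
  classical
  have hlB := D.log_B_pos
  obtain ⟨ε, hε0, hε1, hε2, hε3⟩ : ∃ ε : ℝ, 0 < ε ∧ s * ε ≤ δ ∧ (σ - s) * ε ≤ δ ∧
      α + ε ≤ -Real.log (1 - q) / Real.log B := by
    refine ⟨min (min (δ / (s + 1)) (δ / (σ - s + 1))) (-Real.log (1 - q) / Real.log B - α),
      lt_min (lt_min (div_pos hδ (by linarith)) (div_pos hδ (by linarith))) (by linarith),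
      ?_, ?_, ?_⟩
    · calc _ ≤ s * (δ / (s + 1)) :=
            mul_le_mul_of_nonneg_left ((min_le_left _ _).trans (min_le_left _ _)) hs0
        _ ≤ δ := by rw [← mul_div_assoc, div_le_iff₀ (by linarith)]; nlinarith
    · calc _ ≤ (σ - s) * (δ / (σ - s + 1)) :=
            mul_le_mul_of_nonneg_left ((min_le_left _ _).trans (min_le_right _ _)) (by linarith)
        _ ≤ δ := by rw [← mul_div_assoc, div_le_iff₀ (by linarith)]; nlinarith
    · have := min_le_right (min (δ / (s + 1)) (δ / (σ - s + 1)))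
        (-Real.log (1 - q) / Real.log B - α)
      linarith
  let Good : ∀ n : ℕ, (Fin n → Bool) → Prop := fun n w => ∃ ω : ℕ → Bool, (∀ k : Fin n, ω k = w k) ∧
    ∃ i, N (2 * i) < n ∧ n ≤ N (2 * i + 1) ∧ logMass r n ω ≤ (α + ε) * logScale c n ∧
      logMass r (N (2 * i)) ω ≤ (α' + ε) * logScale c (N (2 * i))
  refine dimH_le_of_cover D.two_lt D.B_le ht0 (Real.exp_pos (-(δ * Real.log B))).le
    (Real.exp_lt_one_iff.2 (by nlinarith)) (fun n => Finset.univ.filter (Good n)) ?_ ?_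
  · rintro x ⟨hx, hlow, hup⟩
    obtain ⟨ω, rfl⟩ := (mem_moranSet_iff D.two_lt D.B_le).1 hx
    obtain ⟨e1, e2⟩ := localDim_point D.two_lt D.B_le D.min_pos D.r_mem hμ D.le_A ω
    have hbd : ∀ᶠ n in atTop, |logMass r n ω / logScale c n| ≤
        -Real.log (min p q) / Real.log B := Eventually.of_forall fun n => by
      have := ratio_mem D.two_lt D.B_le D.min_pos D.r_mem ω n
      rw [abs_of_nonneg this.1]
      exact this.2
    rw [e1] at hlow
    rw [e2] at hup
    have hev := eventually_lt_of_limsup_lt (hup.trans_lt (lt_add_of_pos_right α' hε0))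
      (isBoundedUnder_le_of_abs hbd)
    have hfr := frequently_lt_of_liminf_lt (isBoundedUnder_le_of_abs hbd).isCoboundedUnder_ge
      (hlow.trans_lt (lt_add_of_pos_right α hε0))
    obtain ⟨n₀, hn₀⟩ := eventually_atTop.1 hev
    have hn₀' : ∀ n, n₀ ≤ n → logMass r n ω ≤ (α' + ε) * logScale c n := by
      intro n hn
      rcases Nat.eq_zero_or_pos n with rfl | hpos
      · simp [logMass, logScale]
      · exact ((div_lt_iff₀ (D.logScale_pos hpos)).1 (hn₀ n hn)).le
    refine ⟨ω, rfl, frequently_atTop.2 fun m => ?_⟩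
    obtain ⟨n, hn, hnlt⟩ := (frequently_atTop.1 hfr) (N (2 * (max m n₀) + 2) + 1)
    obtain ⟨j, hj1, hj2⟩ := D.exists_block (n - 1)
    rw [div_lt_iff₀ (D.logScale_pos (by omega))] at hnlt
    have hm1 := le_max_left m n₀
    have hm2 := le_max_right m n₀
    have hj : 2 * (max m n₀) + 2 ≤ j := by
      have := D.mono.lt_iff_lt.1 (show N (2 * (max m n₀) + 2) < N (j + 1) by omega)
      omega
    have hNj : j ≤ N j := D.mono.id_le j
    rcases Nat.even_or_odd' j with ⟨i, rfl | rfl⟩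
    · refine ⟨n, by omega, Finset.mem_filter.2 ⟨Finset.mem_univ _, ω, fun _ => rfl, i, by omega,
        by omega, hnlt.le, hn₀' _ (by omega)⟩⟩
    · have hN2 : 2 * i ≤ N (2 * i) := D.mono.id_le (2 * i)
      refine ⟨N (2 * i + 1), by omega, Finset.mem_filter.2 ⟨Finset.mem_univ _, ω, fun _ => rfl, i,
        D.mono (by omega), le_rfl, ?_, hn₀' _ (by omega)⟩⟩
      have h1 := D.logMass_sub_ge (i := i) (n := n) (by omega) (by rw [show 2 * i + 2 = 2 * i + 1 + 1 by ring]; omega) ω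
      have h2 := logScale_mono D.two_lt D.B_le (show N (2 * i + 1) ≤ n by omega)
      nlinarith
  · set C := |betaFn p A σ - betaFn q B σ| * Real.log A with hC
    have hC0 : 0 ≤ C := mul_nonneg (abs_nonneg _) D.log_A_pos.le
    have hη : 0 < δ * Real.log B / (C + 1) := by positivity
    have hev : ∀ᶠ j in atTop, (N (j - 1) : ℝ) ≤ δ * Real.log B / (C + 1) * N j := by
      filter_upwards [(tendsto_sub_atTop_nat 1).eventually (D.eventually_le_mul hη),
        eventually_ge_atTop 1] with j h1 h2
      rwa [Nat.sub_add_cancel h2] at h1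
    filter_upwards [D.eventually_forall_block hev] with n hn
    by_cases hblock : ∃ i, N (2 * i) < n ∧ n ≤ N (2 * i + 1)
    · obtain ⟨i, hi1, hi2⟩ := hblock
      have hNj := hn (2 * i) hi2
      have hS := D.sum_betaFn_ge σ s hi1.le hi2
      have hcard := card_le_exp D.one_lt_c D.r_pos_lt (fun k => if k < N (2 * i) then σ else s)
        (Finset.univ.filter (Good n))
        (K := s * ((α + ε) * logScale c n) + (σ - s) * ((α' + ε) * logScale c (N (2 * i)))) ?_
      · have hΛn := logScale_ge D.two_lt D.B_le n
        have hΛM : logScale c (N (2 * i)) ≤ logScale c n := logScale_mono D.two_lt D.B_le hi1.le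
        have hΛM0 : 0 ≤ logScale c (N (2 * i)) :=
          le_trans (by positivity) (logScale_ge D.two_lt D.B_le (N (2 * i)))
        refine (mul_le_mul_of_nonneg_right hcard (Real.rpow_nonneg (scale_pos c n).le t)).trans ?_
        rw [scale, ← Real.exp_mul, ← Real.exp_add, ← Real.exp_nat_mul, Real.exp_le_exp]
        rw [div_mul_eq_mul_div, le_div_iff₀ (by positivity)] at hNj
        have hin : (N (2 * i) : ℝ) ≤ n := by exact_mod_cast hi1.le
        have hCN : C * N (2 * i - 1) ≤ δ * logScale c n := by
          have : δ * Real.log B * N (2 * i) ≤ δ * Real.log B * n := by gcongr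
          have : δ * (n * Real.log B) ≤ δ * logScale c n := by gcongr
          have : (0 : ℝ) ≤ N (2 * i - 1) := Nat.cast_nonneg _
          nlinarith
        have h1 : (s * α - betaFn p A s + 5 * δ - t) * logScale c n ≤ 0 :=
          mul_nonpos_of_nonpos_of_nonneg (by linarith) (hΛM0.trans hΛM)
        have h2 : (s * ε - δ) * logScale c n ≤ 0 :=
          mul_nonpos_of_nonpos_of_nonneg (by linarith) (hΛM0.trans hΛM)
        have h3 : ((σ - s) * ε - δ) * logScale c (N (2 * i)) ≤ 0 :=
          mul_nonpos_of_nonpos_of_nonneg (by linarith) hΛM0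
        have h4 : (σ * α' - betaFn q B σ - (s * α' - betaFn p A s + δ)) *
            logScale c (N (2 * i)) ≤ 0 :=
          mul_nonpos_of_nonpos_of_nonneg (by linarith) hΛM0
        have h5 : δ * (n * Real.log B) ≤ δ * logScale c n := by gcongr
        have h6 : δ * logScale c (N (2 * i)) ≤ δ * logScale c n := by gcongr
        nlinarith
      · intro w hw
        obtain ⟨-, ω, hω, i', hi1', hi2', hSn, hSM⟩ := Finset.mem_filter.1 hw
        have : i = i' := by
          have h1 := D.mono.lt_iff_lt.1 (hi1.trans_le hi2')
          have h2 := D.mono.lt_iff_lt.1 (hi1'.trans_le hi2)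
          omega
        subst this
        have e : ∑ k : Fin n, (if (k : ℕ) < N (2 * i) then σ else s) * info r k (w k) =
            s * logMass r n ω + (σ - s) * logMass r (N (2 * i)) ω := by
          simp only [← hω]
          rw [Fin.sum_univ_eq_sum_range
            (fun k => (if k < N (2 * i) then σ else s) * info r k (ω k)) n, logMass, logMass,
            ← Finset.sum_range_add_sum_Ico _ hi1.le, ← Finset.sum_range_add_sum_Ico _ hi1.le,
            mul_add, add_right_comm, Finset.mul_sum, Finset.mul_sum, Finset.mul_sum,
            ← Finset.sum_add_distrib]
          congr 1
          · refine Finset.sum_congr rfl fun k hk => ?_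
            rw [if_pos (Finset.mem_range.1 hk)]
            ring
          · refine Finset.sum_congr rfl fun k hk => ?_
            rw [if_neg (by have := (Finset.mem_Ico.1 hk).1; omega)]
        rw [e]
        have := mul_le_mul_of_nonneg_left hSn hs0
        have := mul_le_mul_of_nonneg_left hSM (sub_nonneg.2 hsσ)
        linarith
    · have : Finset.univ.filter (Good n) = ∅ := by
        refine Finset.filter_eq_empty_iff.2 fun w _ hw => hblock ?_
        obtain ⟨ω, -, i, h1, h2, -⟩ := hw
        exact ⟨i, h1, h2⟩
      rw [this]
      simp only [Finset.card_empty, Nat.cast_zero, zero_mul]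
      positivity

end IsAlternating

end

section

variable {A B p q : ℝ} {N : ℕ → ℕ} {c r : ℕ → ℝ}

lemma deriv_betaFn_zero {ρ C : ℝ} (h0 : 0 < ρ) (h1 : ρ < 1) :
    deriv (betaFn ρ C) 0 = -((Real.log ρ + Real.log (1 - ρ)) / 2) / Real.log C := by
  rw [(hasDerivAt_betaFn h0 h1 0).deriv]
  norm_num

namespace IsAlternating

variable (D : IsAlternating A B p q N c r)
include D

lemma deriv_zero_le : deriv (betaFn p A) 0 ≤ -Real.log p / Real.log A := by
  have h0 := D.p_pos
  have h1 := D.p_le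
  rw [deriv_betaFn_zero h0 (by linarith)]
  refine div_le_div_of_nonneg_right ?_ D.log_A_pos.le
  have := Real.log_le_log h0 (show p ≤ 1 - p by linarith)
  linarith

variable {μ : Measure ℝ} [IsProbabilityMeasure μ]

lemma dimH_level_le_min
    (hμ : ∀ w : List Bool, μ (moranI c w) = ENNReal.ofReal (cylMass r w 1 1))
    (hpq : -Real.log p / Real.log A < -Real.log (1 - q) / Real.log B)
    {α α' s₁ : ℝ} (hα' : α' < deriv (betaFn q B) 1) (hs0 : 0 ≤ s₁) (hs1 : s₁ ≤ 1)
    (htan : legendre (betaFn q B) α' = s₁ * α' - betaFn p A s₁)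
    (hα : α < deriv (betaFn p A) 0) :
    dimH {x | x ∈ moranSet c ∧ lowerLocalDim μ x = α ∧ upperLocalDim μ x = α'} ≤
      ENNReal.ofReal (min (Real.log 2 / Real.log A) (s₁ * α - betaFn p A s₁)) := by
  rw [ENNReal.ofReal_min]
  refine le_min ((dimH_mono fun x hx => hx.1).trans D.dimH_moranSet_le) ?_
  refine le_of_forall_gt_imp_ge_of_dense fun a ha => ?_
  rcases eq_or_ne a ⊤ with rfl | hatop
  · exact le_top
  obtain ⟨t, rfl⟩ : ∃ t : ℝ, a = ENNReal.ofReal t := ⟨a.toReal, (ENNReal.ofReal_toReal hatop).symm⟩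
  obtain ⟨ht, ht0⟩ := ENNReal.ofReal_lt_ofReal_iff'.1 ha
  set δ := (t - (s₁ * α - betaFn p A s₁)) / 5 with hδ
  have hδ0 : 0 < δ := by linarith
  have hαb : α < -Real.log (1 - q) / Real.log B := by linarith [D.deriv_zero_le]
  obtain ⟨s', hs'⟩ := exists_lt_of_ciInf_lt
    (show (⨅ s : ℝ, (s * α' - betaFn q B s)) < s₁ * α' - betaFn p A s₁ + δ by
      rw [← legendre, htan]; linarith)
  rcases le_total 1 s' with h | h
  · exact D.dimH_level_le hμ hs0 (hs1.trans h) hαb hδ0 hs'.le ht0 (by linarith)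
  · refine D.dimH_level_le hμ hs0 hs1 hαb hδ0 ?_ ht0 (by linarith)
    have := betaFn_le_tangent D.q_pos (by linarith [D.q_le]) (show 1 < B by linarith [D.two_lt]) s' 1
    nlinarith

end IsAlternating

end

section

variable {A B : ℝ} {c : ℕ → ℝ}

section MassDistribution

variable (hB2 : 2 < B) (hcB : ∀ k, B ≤ c (k + 1))
include hB2 hcB

/-- Addresses of points in a set of small diameter share a long prefix. -/
lemma eq_of_mem_closure {s : Set ℝ} {j : ℕ}
    (hs : ediam s < ENNReal.ofReal ((1 - 2 / B) * scale c j)) {ω ω' : ℕ → Bool}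
    (h : point c ω ∈ closure s) (h' : point c ω' ∈ closure s) : ∀ k < j + 1, ω k = ω' k := by
  intro k hk
  refine eq_of_dist_lt hB2 hcB (Nat.lt_succ_self j) (Nat.lt_succ_self j)
    (point_mem hB2 hcB (j + 1) ω) (point_mem hB2 hcB (j + 1) ω') ?_ k (by omega)
  have := (edist_le_ediam_of_mem h h').trans_lt ((ediam_closure s).trans_lt hs)
  rw [edist_dist, ENNReal.ofReal_lt_ofReal_iff_of_nonneg dist_nonneg, Real.dist_eq] at this
  exact this

lemma le_dimH_of_measure {t : ℝ} (ht : 0 < t) (P : Measure (ℕ → Bool)) (F : Set (ℕ → Bool))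
    (hF0 : P F ≠ 0)
    (hF : ∀ ω ∈ F, ∀ᶠ n in atTop, P {ω' | ∀ k < n, ω' k = ω k} ≤ ENNReal.ofReal (scale c n ^ t)) :
    ENNReal.ofReal t ≤ dimH (point c '' F) := by
  set κ := 1 - 2 / B with hκ
  have hκ0 : 0 < κ := gap_pos hB2
  let Fm : ℕ → Set (ℕ → Bool) := fun m => {ω ∈ F | ∀ n ≥ m,
    P {ω' | ∀ k < n, ω' k = ω k} ≤ ENNReal.ofReal (scale c n ^ t)}
  obtain ⟨m, hm⟩ : ∃ m, P (Fm m) ≠ 0 := by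
    by_contra! h
    refine hF0 (measure_mono_null ?_ (measure_iUnion_null_iff.2 h))
    intro ω hω
    obtain ⟨m, hm⟩ := eventually_atTop.1 (hF ω hω)
    exact mem_iUnion.2 ⟨m, hω, hm⟩
  have hmeas : Measurable (point c) := (continuous_point hB2 hcB).measurable
  let ν := (P.restrict (Fm m)).map (point c)
  have hlevel : ∀ (s : Set ℝ) (j : ℕ), m ≤ j + 1 → ediam s < ENNReal.ofReal (κ * scale c j) →
      ν s ≤ ENNReal.ofReal (scale c (j + 1) ^ t) := by
    intro s j hj hs
    refine (measure_mono subset_closure).trans ?_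
    rw [Measure.map_apply hmeas isClosed_closure.measurableSet,
      Measure.restrict_apply (hmeas isClosed_closure.measurableSet)]
    rcases eq_empty_or_nonempty (point c ⁻¹' closure s ∩ Fm m) with h | ⟨ω, h1, h2⟩
    · rw [h]
      simp
    · refine (measure_mono ?_).trans (h2.2 (j + 1) hj)
      rintro ω' ⟨h3, -⟩
      exact eq_of_mem_closure hB2 hcB hs h3 h1
  have hν : ENNReal.ofReal (κ ^ t) • ν ≤ μH[t] := by
    refine Measure.le_hausdorffMeasure t _ (ENNReal.ofReal (κ * scale c m / 2)) ?_ fun s hs => ?_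
    · have := scale_pos c m
      rw [ENNReal.ofReal_pos]
      positivity
    have htop : ediam s ≠ ⊤ := ne_top_of_le_ne_top ENNReal.ofReal_ne_top hs
    obtain ⟨d, hd0, hd⟩ : ∃ d : ℝ, 0 ≤ d ∧ ediam s = ENNReal.ofReal d :=
      ⟨(ediam s).toReal, ENNReal.toReal_nonneg, (ENNReal.ofReal_toReal htop).symm⟩
    have hdm : d < κ * scale c m := by
      have h0 := mul_pos hκ0 (scale_pos c m)
      rw [hd, ENNReal.ofReal_le_ofReal_iff (by linarith)] at hs
      linarith
    rw [Measure.smul_apply, smul_eq_mul, hd, ENNReal.ofReal_rpow_of_nonneg hd0 ht.le]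
    rcases hd0.eq_or_lt with rfl | hdpos
    · have : ν s ≤ 0 := by
        have hlim : Tendsto (fun j => ENNReal.ofReal (scale c (j + 1) ^ t)) atTop (𝓝 0) := by
          rw [← ENNReal.ofReal_zero]
          refine ENNReal.tendsto_ofReal ?_
          rw [← Real.zero_rpow ht.ne']
          exact ((tendsto_scale hB2 hcB).comp (tendsto_add_atTop_nat 1)).rpow_const
            (Or.inr ht.le)
        refine ge_of_tendsto hlim ?_
        filter_upwards [eventually_ge_atTop m] with j hj
        refine hlevel s j (by omega) ?_
        rw [hd, ENNReal.ofReal_zero, ENNReal.ofReal_pos]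
        exact mul_pos hκ0 (scale_pos c j)
      rw [nonpos_iff_eq_zero.1 this, mul_zero]
      exact zero_le
    · have hex : ∃ n, κ * scale c (m + n) ≤ d := by
        have : Tendsto (fun n => κ * scale c (m + n)) atTop (𝓝 0) := by
          rw [← mul_zero κ]
          refine ((tendsto_scale hB2 hcB).comp ?_).const_mul κ
          simpa [add_comm] using tendsto_add_atTop_nat m
        obtain ⟨n, hn⟩ := (this.eventually_lt_const hdpos).exists
        exact ⟨n, hn.le⟩
      classical
      have hspec := Nat.find_spec hex
      have hne : Nat.find hex ≠ 0 := by
        intro h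
        rw [h] at hspec
        exact absurd hspec (not_le.2 hdm)
      obtain ⟨n, hn⟩ := Nat.exists_eq_succ_of_ne_zero hne
      have hmin := not_le.1 (Nat.find_min hex (show n < Nat.find hex by omega))
      rw [hn] at hspec
      have := hlevel s (m + n) (by omega) (by
        rw [hd]; exact (ENNReal.ofReal_lt_ofReal_iff (hdpos.trans hmin)).2 hmin)
      calc _ ≤ ENNReal.ofReal (κ ^ t) * ENNReal.ofReal (scale c (m + n + 1) ^ t) := by gcongr
        _ = ENNReal.ofReal ((κ * scale c (m + n + 1)) ^ t) := by
            rw [← ENNReal.ofReal_mul (by positivity), Real.mul_rpow hκ0.le (scale_pos c _).le]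
        _ ≤ _ := ENNReal.ofReal_le_ofReal
            (Real.rpow_le_rpow (mul_nonneg hκ0.le (scale_pos c _).le) hspec ht.le)
  have hpos : μH[t] (point c '' F) ≠ 0 := by
    have h1 : P (Fm m) ≤ ν (point c '' F) := by
      refine le_trans ?_ (Measure.le_map_apply hmeas.aemeasurable _)
      rw [← Measure.restrict_apply_self P (Fm m)]
      exact measure_mono fun ω hω => mem_image_of_mem _ hω.1
    have h2 : ENNReal.ofReal (κ ^ t) * ν (point c '' F) ≤ μH[t] (point c '' F) := hν _
    intro h0
    rw [h0, nonpos_iff_eq_zero, mul_eq_zero, ENNReal.ofReal_eq_zero] at h2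
    rcases h2 with h2 | h2
    · exact absurd h2 (not_le.2 (Real.rpow_pos_of_pos hκ0 t))
    · exact hm (nonpos_iff_eq_zero.1 (h2 ▸ h1))
  have := le_dimH_of_hausdorffMeasure_ne_zero (s := point c '' F) (d := t.toNNReal)
    (by rwa [Real.coe_toNNReal _ ht.le])
  exact this

end MassDistribution

end

section

variable {r θ : ℕ → ℝ} {ρ : ℝ}

section Coin

open ProbabilityTheory

/-- The law on `Bool` which gives mass `x` to `false`. -/
noncomputable def coin (x : ℝ) : Measure Bool :=
  ENNReal.ofReal x • Measure.dirac false + ENNReal.ofReal (1 - x) • Measure.dirac true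

lemma isProbabilityMeasure_coin {x : ℝ} (h0 : 0 ≤ x) (h1 : x ≤ 1) :
    IsProbabilityMeasure (coin x) := ⟨by
  simp [coin, ← ENNReal.ofReal_add h0 (sub_nonneg.2 h1)]⟩

lemma coin_singleton (x : ℝ) (b : Bool) :
    coin x {b} = ENNReal.ofReal (if b then 1 - x else x) := by
  cases b <;> simp [coin]

lemma integral_coin {x : ℝ} (h0 : 0 ≤ x) (h1 : x ≤ 1) (f : Bool → ℝ) :
    ∫ b, f b ∂coin x = x * f false + (1 - x) * f true := by
  rw [coin, integral_add_measure ((Integrable.of_finite).smul_measure ENNReal.ofReal_ne_top)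
    ((Integrable.of_finite).smul_measure ENNReal.ofReal_ne_top), integral_smul_measure, integral_smul_measure,
    integral_dirac, integral_dirac, ENNReal.toReal_ofReal h0, ENNReal.toReal_ofReal (by linarith)]
  rfl

/-- The law of a sequence of independent letters whose `k`-th letter is `false` with
probability `θ (k + 1)`. -/
noncomputable def coinMeasure (θ : ℕ → ℝ) : Measure (ℕ → Bool) :=
  Measure.infinitePi fun k => coin (θ (k + 1))

/-- The mean of `info r k` when `false` has probability `θ (k + 1)`. -/
noncomputable def meanInfo (r θ : ℕ → ℝ) (k : ℕ) : ℝ :=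
  θ (k + 1) * info r k false + (1 - θ (k + 1)) * info r k true

lemma info_mem_Icc (hρ : 0 < ρ) (hr : ∀ k, ρ ≤ r (k + 1) ∧ r (k + 1) ≤ 1 - ρ) (k : ℕ) (b : Bool) :
    info r k b ∈ Icc 0 (-Real.log ρ) := by
  have h1 : ρ ≤ (if b then 1 - r (k + 1) else r (k + 1)) := by
    have := hr k
    split_ifs <;> linarith
  have h2 : (if b then 1 - r (k + 1) else r (k + 1)) ≤ 1 := by
    have := hr k
    split_ifs <;> linarith
  exact ⟨neg_nonneg.2 (Real.log_nonpos (hρ.le.trans h1) h2), neg_le_neg (Real.log_le_log hρ h1)⟩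

variable (hθ : ∀ k, 0 < θ (k + 1) ∧ θ (k + 1) < 1)
include hθ

lemma isProbabilityMeasure_coinMeasure : IsProbabilityMeasure (coinMeasure θ) := by
  have := fun k => isProbabilityMeasure_coin (hθ k).1.le (hθ k).2.le
  unfold coinMeasure
  infer_instance

lemma coinMeasure_cyl (n : ℕ) (ω : ℕ → Bool) :
    coinMeasure θ {ω' | ∀ k < n, ω' k = ω k} = ENNReal.ofReal (Real.exp (-logMass θ n ω)) := by
  have := fun k => isProbabilityMeasure_coin (hθ k).1.le (hθ k).2.le
  have e : {ω' : ℕ → Bool | ∀ k < n, ω' k = ω k} =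
      (↑(Finset.range n) : Set ℕ).pi fun k => {ω k} := by
    ext ω'
    simp [Set.mem_pi]
  rw [e, coinMeasure, Measure.infinitePi_pi _ fun _ _ => measurableSet_singleton _]
  simp only [coin_singleton]
  rw [← ENNReal.ofReal_prod_of_nonneg, logMass, ← Finset.sum_neg_distrib, Real.exp_sum]
  · congr 1
    refine Finset.prod_congr rfl fun k _ => ?_
    rw [info, neg_neg, Real.exp_log]
    split_ifs <;> linarith [hθ k]
  · intro k _
    split_ifs <;> linarith [hθ k]

lemma eventually_sum_lt {φ : ℕ → Bool → ℝ} {C : ℝ} (hφ : ∀ k b, φ k b ∈ Icc 0 C) {ε : ℝ}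
    (hε : 0 < ε) : ∀ᵐ ω ∂coinMeasure θ, ∀ᶠ n : ℕ in atTop, ∑ k ∈ Finset.range n,
      (φ k (ω k) - (θ (k + 1) * φ k false + (1 - θ (k + 1)) * φ k true)) < ε * n := by
  have := fun k => isProbabilityMeasure_coin (hθ k).1.le (hθ k).2.le
  have := isProbabilityMeasure_coinMeasure hθ
  have hC : 0 ≤ C := (hφ 0 false).1.trans (hφ 0 false).2
  set X : ℕ → (ℕ → Bool) → ℝ := fun k ω =>
    φ k (ω k) - (θ (k + 1) * φ k false + (1 - θ (k + 1)) * φ k true) with hX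
  set K : NNReal := (‖(C + 1) - 0‖₊ / 2) ^ 2 with hK
  have hKpos : 0 < K := by
    have : 0 < ‖(C + 1) - 0‖₊ := nnnorm_pos.2 (by linarith)
    positivity
  have hind : iIndepFun X (coinMeasure θ) :=
    iIndepFun_infinitePi (P := fun k => coin (θ (k + 1))) (X := fun k b =>
      φ k b - (θ (k + 1) * φ k false + (1 - θ (k + 1)) * φ k true))
      fun k => measurable_of_finite _
  have hsub : ∀ k, HasSubgaussianMGF (X k) K (coinMeasure θ) := by
    intro k
    have h1 := hasSubgaussianMGF_of_mem_Icc (μ := coin (θ (k + 1))) (X := φ k) (a := 0) (b := C + 1)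
      (measurable_of_finite _).aemeasurable
      (Eventually.of_forall fun b => ⟨(hφ k b).1, (hφ k b).2.trans (by linarith)⟩)
    rw [integral_coin (hθ k).1.le (hθ k).2.le] at h1
    refine HasSubgaussianMGF.of_map (Y := fun ω : ℕ → Bool => ω k)
      (X := fun b => φ k b - (θ (k + 1) * φ k false + (1 - θ (k + 1)) * φ k true))
      (measurable_pi_apply k).aemeasurable ?_
    have h2 := (measurePreserving_eval_infinitePi (fun k => coin (θ (k + 1))) k).map_eq
    rw [coinMeasure, show (fun ω : ℕ → Bool => ω k) = Function.eval k from rfl, h2]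
    exact h1
  have hbound : ∀ n : ℕ, coinMeasure θ {ω | ε * n ≤ ∑ k ∈ Finset.range n, X k ω} ≤
      ENNReal.ofReal (Real.exp (n * (-(ε ^ 2 / (2 * K))))) := by
    intro n
    have h := HasSubgaussianMGF.measure_sum_range_ge_le_of_iIndepFun hind (n := n)
      (fun i _ => hsub i) (show 0 ≤ ε * n by positivity)
    rw [← ENNReal.ofReal_toReal (measure_ne_top (coinMeasure θ) _)]
    refine ENNReal.ofReal_le_ofReal (h.trans (le_of_eq ?_))
    congr 1
    rcases Nat.eq_zero_or_pos n with rfl | hn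
    · simp
    · have : (n : ℝ) ≠ 0 := by positivity
      have : (K : ℝ) ≠ 0 := by positivity
      field_simp
  have hsum : ∑' n : ℕ, coinMeasure θ {ω | ε * n ≤ ∑ k ∈ Finset.range n, X k ω} ≠ ⊤ := by
    refine ne_top_of_le_ne_top ?_ (ENNReal.tsum_le_tsum hbound)
    refine (Real.summable_exp_nat_mul_iff.2 ?_).tsum_ofReal_ne_top
    have : (0 : ℝ) < K := hKpos
    have : 0 < ε ^ 2 / (2 * (K : ℝ)) := by positivity
    linarith
  filter_upwards [ae_eventually_notMem hsum] with ω hω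
  filter_upwards [hω] with n hn
  exact not_le.1 hn

/-- The strong law of large numbers for the information of a random sequence of letters. -/
lemma tendsto_logMass_sub (hρ : 0 < ρ) (hr : ∀ k, ρ ≤ r (k + 1) ∧ r (k + 1) ≤ 1 - ρ) :
    ∀ᵐ ω ∂coinMeasure θ, Tendsto (fun n : ℕ =>
      (logMass r n ω - ∑ k ∈ Finset.range n, meanInfo r θ k) / n) atTop (𝓝 0) := by
  have h1 : ∀ᵐ ω ∂coinMeasure θ, ∀ m : ℕ, ∀ᶠ n : ℕ in atTop,
      |logMass r n ω - ∑ k ∈ Finset.range n, meanInfo r θ k| ≤ 1 / ((m : ℝ) + 1) * n := by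
    refine ae_all_iff.2 fun m => ?_
    filter_upwards [eventually_sum_lt hθ (fun k b => info_mem_Icc hρ hr k b)
        (show 0 < 1 / ((m : ℝ) + 1) by positivity),
      eventually_sum_lt hθ (φ := fun k b => -Real.log ρ - info r k b) (C := -Real.log ρ)
        (fun k b => by
          have := info_mem_Icc hρ hr k b
          constructor <;> linarith [this.1, this.2])
        (show 0 < 1 / ((m : ℝ) + 1) by positivity)] with ω h1 h2
    filter_upwards [h1, h2] with n hn1 hn2
    rw [logMass, ← Finset.sum_sub_distrib, abs_le]
    refine ⟨?_, hn1.le⟩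
    rw [neg_le, ← Finset.sum_neg_distrib]
    refine le_trans (le_of_eq (Finset.sum_congr rfl fun k _ => ?_)) hn2.le
    rw [meanInfo]
    ring
  filter_upwards [h1] with ω hω
  rw [Metric.tendsto_atTop]
  intro ε hε
  obtain ⟨m, hm⟩ := exists_nat_one_div_lt hε
  obtain ⟨n₀, hn₀⟩ := eventually_atTop.1 (hω m)
  refine ⟨n₀ + 1, fun n hn => ?_⟩
  have hn0 : (0 : ℝ) < n := by exact_mod_cast (show 0 < n by omega)
  rw [Real.dist_eq, sub_zero, abs_div, abs_of_pos hn0]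
  refine lt_of_le_of_lt ?_ hm
  rw [div_le_iff₀ hn0]
  exact hn₀ n (by omega)

end Coin

end

section

variable {A B p q : ℝ} {N : ℕ → ℕ} {c r : ℕ → ℝ}

lemma sum_range_eq_add {y : ℕ → ℝ} {a : ℝ} {m n : ℕ} (hmn : m ≤ n)
    (hy : ∀ k, m ≤ k → k < n → y k = a) :
    ∑ k ∈ Finset.range n, y k = ∑ k ∈ Finset.range m, y k + (n - m : ℝ) * a := by
  have : ∑ k ∈ Finset.Ico m n, y k = ∑ k ∈ Finset.Ico m n, a :=
    Finset.sum_congr rfl fun k hk => hy k (Finset.mem_Ico.1 hk).1 (Finset.mem_Ico.1 hk).2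
  rw [← Finset.sum_range_add_sum_Ico _ hmn, this, Finset.sum_const, Nat.card_Ico, nsmul_eq_mul,
    Nat.cast_sub hmn]

/-- The sequence `y` equals `b` on blocks of odd index, and on a block of even index it equals `a₁`
before time `T i` and `a₂` afterwards. -/
structure IsTwoPhase (N T : ℕ → ℕ) (a₁ a₂ b : ℝ) (y : ℕ → ℝ) : Prop where
  left : ∀ i, N (2 * i) ≤ T i
  right : ∀ i, T i ≤ N (2 * i + 1)
  first : ∀ i k, N (2 * i) ≤ k → k < T i → y k = a₁
  second : ∀ i k, T i ≤ k → k < N (2 * i + 1) → y k = a₂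
  odd : ∀ i k, N (2 * i + 1) ≤ k → k < N (2 * i + 2) → y k = b

namespace IsTwoPhase

variable {T : ℕ → ℕ} {a₁ a₂ b : ℝ} {y : ℕ → ℝ}

lemma sum_first (h : IsTwoPhase N T a₁ a₂ b y) {i n : ℕ} (h1 : N (2 * i) ≤ n) (h2 : n ≤ T i) :
    ∑ k ∈ Finset.range n, y k = ∑ k ∈ Finset.range (N (2 * i)), y k + (n - N (2 * i) : ℝ) * a₁ := by
  exact sum_range_eq_add h1 fun k hk1 hk2 => h.first i k hk1 (by omega)

lemma sum_second (h : IsTwoPhase N T a₁ a₂ b y) {i n : ℕ} (h1 : T i ≤ n) (h2 : n ≤ N (2 * i + 1)) :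
    ∑ k ∈ Finset.range n, y k = ∑ k ∈ Finset.range (T i), y k + (n - T i : ℝ) * a₂ := by
  exact sum_range_eq_add h1 fun k hk1 hk2 => h.second i k hk1 (by omega)

lemma sum_odd (h : IsTwoPhase N T a₁ a₂ b y) {i n : ℕ} (h1 : N (2 * i + 1) ≤ n)
    (h2 : n ≤ N (2 * i + 2)) :
    ∑ k ∈ Finset.range n, y k =
      ∑ k ∈ Finset.range (N (2 * i + 1)), y k + (n - N (2 * i + 1) : ℝ) * b := by
  exact sum_range_eq_add h1 fun k hk1 hk2 => h.odd i k hk1 (by omega)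

lemma cases (h : IsTwoPhase N T a₁ a₂ b y) (D : IsAlternating A B p q N c r) (k : ℕ) :
    y k = a₁ ∨ y k = a₂ ∨ y k = b := by
  obtain ⟨i, ⟨h1, h2⟩ | ⟨h1, h2⟩⟩ := D.block_cases k
  · rcases lt_or_ge k (T i) with h3 | h3
    · exact Or.inl (h.first i k h1 h3)
    · exact Or.inr (Or.inl (h.second i k h3 h2))
  · exact Or.inr (Or.inr (h.odd i k h1 h2))

/-- At the end of a block of odd index the sum is governed by that block. -/
lemma abs_sum_sub_le (h : IsTwoPhase N T a₁ a₂ b y) (D : IsAlternating A B p q N c r) (i : ℕ) :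
    |∑ k ∈ Finset.range (N (2 * i)), y k - N (2 * i) * b| ≤
      (|a₁ - b| + |a₂ - b|) * N (2 * i - 1) := by
  have := abs_sum_sub_sum_le (f := y) (g := fun _ => b) (C := |a₁ - b| + |a₂ - b|)
    (m := N (2 * i - 1)) (n := N (2 * i)) ?_ ?_
  · simpa using this
  · intro k
    have := abs_nonneg (a₁ - b)
    have := abs_nonneg (a₂ - b)
    rcases h.cases D k with h | h | h <;> rw [h]
    · linarith
    · linarith
    · rw [sub_self, abs_zero]
      positivity
  · intro k hk1 hk2
    rcases i with _ | i
    · simp [D.zero] at hk2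
    · exact h.odd i k hk1 hk2

end IsTwoPhase

lemma IsAlternating.logScale_even_le (D : IsAlternating A B p q N c r) (i : ℕ) :
    logScale c (N (2 * i)) ≤ N (2 * i) * Real.log B + Real.log A * N (2 * i - 1) := by
  have := abs_sum_sub_sum_le (f := fun k => Real.log (c (k + 1))) (g := fun _ => Real.log B)
    (C := Real.log A) (m := N (2 * i - 1)) (n := N (2 * i)) ?_ ?_
  · simp only [Finset.sum_const, Finset.card_range, nsmul_eq_mul] at this
    have := (abs_le.1 this).2
    rw [logScale]
    linarith
  · intro k
    have := D.log_c_mem k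
    rw [abs_le]
    constructor <;> linarith [this.1, this.2, D.log_B_pos, D.log_A_pos]
  · intro k hk1 hk2
    rcases i with _ | i
    · simp [D.zero] at hk2
    · simp only [(D.stepB i k hk1 hk2).1]

lemma IsAlternating.eventually_pred_le (D : IsAlternating A B p q N c r) {ε : ℝ} (hε : 0 < ε) :
    ∀ᶠ i in atTop, (N (2 * i - 1) : ℝ) ≤ ε * N (2 * i) := by
  have h2 : Tendsto (fun i : ℕ => 2 * i - 1) atTop atTop :=
    Filter.tendsto_atTop.2 fun b => by
      filter_upwards [eventually_ge_atTop (b + 1)] with i hi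
      omega
  filter_upwards [h2.eventually (D.eventually_le_mul hε), eventually_ge_atTop 1] with i h1 hi
  rwa [show 2 * i - 1 + 1 = 2 * i by omega] at h1

namespace IsTwoPhase

variable {T : ℕ → ℕ} {a₁ a₂ b : ℝ} {y : ℕ → ℝ}

/-- If the loss during the first phase is compensated by the preceding block, the sums of a
two-phase sequence are asymptotically nonnegative. -/
lemma eventually_neg_le (h : IsTwoPhase N T a₁ a₂ b y) (D : IsAlternating A B p q N c r)
    {τ : ℝ} (hτ : 1 ≤ τ)
    (hT : ∀ i, (T i : ℝ) ≤ N (2 * i) + (τ - 1) * logScale c (N (2 * i)) / Real.log A)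
    (hb : 0 ≤ b) (ha₂ : 0 ≤ a₂) (hab : 0 ≤ b / Real.log B + (τ - 1) * (a₁ / Real.log A))
    {ε : ℝ} (hε : 0 < ε) : ∀ᶠ n : ℕ in atTop, -(ε * n) ≤ ∑ k ∈ Finset.range n, y k := by
  have hlA := D.log_A_pos
  have hlB := D.log_B_pos
  set K := |a₁ - b| + |a₂ - b| + (τ - 1) * |a₁| with hK
  have hK0 : 0 ≤ K := by
    have : 0 ≤ (τ - 1) * |a₁| := mul_nonneg (by linarith) (abs_nonneg _)
    positivity
  have hfirst : ∀ i n, N (2 * i) ≤ n → n ≤ T i →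
      -(K * N (2 * i - 1)) ≤ ∑ k ∈ Finset.range n, y k := by
    intro i n h1 h2
    rw [h.sum_first h1 h2]
    have hbase := (abs_le.1 (h.abs_sum_sub_le D i)).1
    have hN0 : (0 : ℝ) ≤ N (2 * i - 1) := Nat.cast_nonneg _
    have hM0 : (0 : ℝ) ≤ N (2 * i) := Nat.cast_nonneg _
    have h1' : (N (2 * i) : ℝ) ≤ n := by exact_mod_cast h1
    rcases le_total 0 a₁ with ha | ha
    · have : 0 ≤ (τ - 1) * |a₁| * N (2 * i - 1) :=
        mul_nonneg (mul_nonneg (by linarith) (abs_nonneg _)) hN0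
      have : 0 ≤ ((n : ℝ) - N (2 * i)) * a₁ := mul_nonneg (by linarith) ha
      have : 0 ≤ (N (2 * i) : ℝ) * b := mul_nonneg hM0 hb
      rw [hK]
      linarith
    · have h2' : (n : ℝ) ≤ T i := by exact_mod_cast h2
      have hΛ := D.logScale_even_le i
      have e1 : (n - N (2 * i) : ℝ) ≤
          (τ - 1) / Real.log A * (N (2 * i) * Real.log B + Real.log A * N (2 * i - 1)) := by
        have := hT i
        rw [mul_div_right_comm] at this
        have := mul_le_mul_of_nonneg_left hΛ (show 0 ≤ (τ - 1) / Real.log A by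
          have : 0 ≤ τ - 1 := by linarith
          positivity)
        linarith
      have e2 := mul_le_mul_of_nonpos_right e1 ha
      have e3 : (τ - 1) / Real.log A * (N (2 * i) * Real.log B + Real.log A * N (2 * i - 1)) * a₁ =
          N (2 * i) * Real.log B * (b / Real.log B + (τ - 1) * (a₁ / Real.log A)) -
          N (2 * i) * b - (τ - 1) * |a₁| * N (2 * i - 1) := by
        rw [abs_of_nonpos ha]
        field_simp
        ring
      have e4 : 0 ≤ N (2 * i) * Real.log B * (b / Real.log B + (τ - 1) * (a₁ / Real.log A)) := by
        positivity
      rw [hK]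
      linarith
  have hev : ∀ i n, N (2 * i) ≤ n → n ≤ N (2 * i + 1) →
      -(K * N (2 * i - 1)) ≤ ∑ k ∈ Finset.range n, y k := by
    intro i n h1 h2
    rcases le_total n (T i) with h3 | h3
    · exact hfirst i n h1 h3
    · rw [h.sum_second h3 h2]
      have := hfirst i (T i) (h.left i) le_rfl
      have h3' : (T i : ℝ) ≤ n := by exact_mod_cast h3
      have : 0 ≤ ((n : ℝ) - T i) * a₂ := mul_nonneg (by linarith) ha₂
      linarith
  have hall : ∀ i n, N (2 * i) ≤ n → n ≤ N (2 * i + 2) →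
      -(K * N (2 * i - 1)) ≤ ∑ k ∈ Finset.range n, y k := by
    intro i n h1 h2
    rcases le_total n (N (2 * i + 1)) with h3 | h3
    · exact hev i n h1 h3
    · rw [h.sum_odd h3 h2]
      have := hev i _ (D.mono.monotone (show 2 * i ≤ 2 * i + 1 by omega)) le_rfl
      have h3' : (N (2 * i + 1) : ℝ) ≤ n := by exact_mod_cast h3
      have : 0 ≤ ((n : ℝ) - N (2 * i + 1)) * b := mul_nonneg (by linarith) hb
      linarith
  obtain ⟨i₀, hi₀⟩ := eventually_atTop.1 (D.eventually_pred_le (show 0 < ε / (K + 1) by positivity))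
  filter_upwards [eventually_ge_atTop (N (2 * i₀))] with n hn
  obtain ⟨i, hi1, hi2⟩ : ∃ i, N (2 * i) ≤ n ∧ n < N (2 * i + 2) := by
    obtain ⟨i, h | h⟩ := D.block_cases n
    · exact ⟨i, h.1, h.2.trans (D.mono (by omega))⟩
    · exact ⟨i, (D.mono.monotone (by omega)).trans h.1, h.2⟩
  have hi : i₀ ≤ i := by
    have := D.mono.lt_iff_lt.1 (hn.trans_lt hi2)
    omega
  have h1 := hi₀ i hi
  rw [div_mul_eq_mul_div, le_div_iff₀ (by positivity)] at h1
  have h2 := hall i n hi1 hi2.le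
  have h3 : ε * N (2 * i) ≤ ε * n := by gcongr
  have hN0 : (0 : ℝ) ≤ N (2 * i - 1) := Nat.cast_nonneg _
  linarith

end IsTwoPhase

end

section

variable {A B p q : ℝ} {N : ℕ → ℕ} {c r : ℕ → ℝ}

section Liminf

variable {u v : ℕ → ℝ} {C a : ℝ}

lemma liminf_eq_of_frequently (hu : ∀ᶠ n in atTop, |u n| ≤ C)
    (h1 : ∀ ε > 0, ∀ᶠ n in atTop, a - ε ≤ u n) (h2 : ∀ ε > 0, ∃ᶠ n in atTop, u n ≤ a + ε) :
    liminf u atTop = a := by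
  refine le_antisymm (le_of_forall_pos_le_add fun ε hε => ?_) (le_of_forall_pos_sub_le fun ε hε => ?_)
  · exact liminf_le_of_frequently_le (h2 ε hε) (isBoundedUnder_ge_of_abs hu)
  · exact le_liminf_of_le (isBoundedUnder_le_of_abs hu).isCoboundedUnder_ge (h1 ε hε)

lemma limsup_eq_of_frequently (hu : ∀ᶠ n in atTop, |u n| ≤ C)
    (h1 : ∀ ε > 0, ∀ᶠ n in atTop, u n ≤ a + ε) (h2 : ∀ ε > 0, ∃ᶠ n in atTop, a - ε ≤ u n) :
    limsup u atTop = a := by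
  refine le_antisymm (le_of_forall_pos_le_add fun ε hε => ?_) (le_of_forall_pos_sub_le fun ε hε => ?_)
  · exact limsup_le_of_le (isBoundedUnder_ge_of_abs hu).isCoboundedUnder_le (h1 ε hε)
  · exact le_limsup_of_frequently_le (h2 ε hε) (isBoundedUnder_le_of_abs hu)

end Liminf

/-- The mean of the information of the weights `ρ`, `1 - ρ` under the probabilities `x`, `1 - x`. -/
noncomputable def crossEntropy (ρ x : ℝ) : ℝ := -(x * Real.log ρ) - (1 - x) * Real.log (1 - ρ)

lemma meanInfo_eq (r θ : ℕ → ℝ) (k : ℕ) :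
    meanInfo r θ k = crossEntropy (r (k + 1)) (θ (k + 1)) := by
  simp [meanInfo, crossEntropy, info]
  ring

lemma exists_isTwoPhase (N T : ℕ → ℕ) (hN : StrictMono N) (hl : ∀ i, N (2 * i) ≤ T i)
    (hr : ∀ i, T i ≤ N (2 * i + 1)) (a₁ a₂ b : ℝ) :
    ∃ θ : ℕ → ℝ, IsTwoPhase N T a₁ a₂ b fun k => θ (k + 1) := by
  classical
  refine ⟨fun n => if ∃ i, N (2 * i) < n ∧ n ≤ T i then a₁ else
    if ∃ i, T i < n ∧ n ≤ N (2 * i + 1) then a₂ else b, hl, hr, ?_, ?_, ?_⟩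
  · intro i k h1 h2
    beta_reduce
    rw [if_pos ⟨i, by omega, by omega⟩]
  · intro i k h1 h2
    beta_reduce
    rw [if_neg, if_pos ⟨i, by omega, by omega⟩]
    rintro ⟨j, hj1, hj2⟩
    have e1 := hN.lt_iff_lt.1 (show N (2 * i) < N (2 * j + 1) by have := hl i; have := hr j; omega)
    have e2 := hN.lt_iff_lt.1 (show N (2 * j) < N (2 * i + 1) by omega)
    have : i = j := by omega
    subst this
    omega
  · intro i k h1 h2
    beta_reduce
    rw [if_neg, if_neg]
    · rintro ⟨j, hj1, hj2⟩
      have e1 := hN.lt_iff_lt.1 (show N (2 * i + 1) < N (2 * j + 1) by omega)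
      have e2 := hN.lt_iff_lt.1 (show N (2 * j) < N (2 * i + 2) by have := hl j; omega)
      omega
    · rintro ⟨j, hj1, hj2⟩
      have e1 := hN.lt_iff_lt.1 (show N (2 * i + 1) < N (2 * j + 1) by have := hr j; omega)
      have e2 := hN.lt_iff_lt.1 (show N (2 * j) < N (2 * i + 2) by omega)
      omega

/-- A functional of the ratio, the weight and the probability of each step is two-phase as soon as
the probabilities are. -/
lemma IsTwoPhase.map {T : ℕ → ℕ} {θ : ℕ → ℝ} {x₁ x₂ z : ℝ}
    (h : IsTwoPhase N T x₁ x₂ z fun k => θ (k + 1)) (D : IsAlternating A B p q N c r)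
    (F : ℝ → ℝ → ℝ → ℝ) :
    IsTwoPhase N T (F A p x₁) (F A p x₂) (F B q z)
      fun k => F (c (k + 1)) (r (k + 1)) (θ (k + 1)) where
  left := h.left
  right := h.right
  first i k h1 h2 := by
    obtain ⟨e1, e2⟩ := D.stepA i k h1 (h2.trans_le (h.right i))
    have := h.first i k h1 h2
    rw [e1, e2, this]
  second i k h1 h2 := by
    obtain ⟨e1, e2⟩ := D.stepA i k ((h.left i).trans h1) h2
    have := h.second i k h1 h2
    rw [e1, e2, this]
  odd i k h1 h2 := by
    obtain ⟨e1, e2⟩ := D.stepB i k h1 h2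
    have := h.odd i k h1 h2
    rw [e1, e2, this]

namespace IsAlternating

/-- The time at which the second phase of the block of index `2 * i` starts. -/
noncomputable def switchTime (A : ℝ) (N : ℕ → ℕ) (c : ℕ → ℝ) (τ : ℝ) (i : ℕ) : ℕ :=
  min (N (2 * i) + ⌊(τ - 1) * logScale c (N (2 * i)) / Real.log A⌋₊) (N (2 * i + 1))

variable (D : IsAlternating A B p q N c r)
include D

lemma le_switchTime (τ : ℝ) (i : ℕ) : N (2 * i) ≤ switchTime A N c τ i :=
  le_min (by omega) (D.mono.monotone (by omega))

lemma logScale_nonneg (n : ℕ) : 0 ≤ logScale c n :=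
  le_trans (mul_nonneg (Nat.cast_nonneg _) D.log_B_pos.le) (logScale_ge D.two_lt D.B_le n)

lemma switchTime_le {τ : ℝ} (hτ : 1 ≤ τ) (i : ℕ) :
    (switchTime A N c τ i : ℝ) ≤ N (2 * i) + (τ - 1) * logScale c (N (2 * i)) / Real.log A := by
  have h := Nat.floor_le (a := (τ - 1) * logScale c (N (2 * i)) / Real.log A)
    (div_nonneg (mul_nonneg (by linarith) (D.logScale_nonneg _)) D.log_A_pos.le)
  have h2 : (switchTime A N c τ i : ℝ) ≤
      (N (2 * i) + ⌊(τ - 1) * logScale c (N (2 * i)) / Real.log A⌋₊ : ℕ) := by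
    exact_mod_cast min_le_left _ _
  push_cast at h2
  linarith

lemma tendsto_two_mul : Tendsto (fun i => N (2 * i)) atTop atTop :=
  D.tendsto_N.comp (Filter.tendsto_atTop.2 fun b => by
    filter_upwards [eventually_ge_atTop b] with i hi
    omega)

lemma eventually_le_switchTime {τ : ℝ} (hτ : 1 ≤ τ) : ∀ᶠ i in atTop,
    N (2 * i) + (τ - 1) * logScale c (N (2 * i)) / Real.log A - 1 ≤ switchTime A N c τ i := by
  have h2 : Tendsto (fun i : ℕ => 2 * i) atTop atTop :=
    Filter.tendsto_atTop.2 fun b => by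
      filter_upwards [eventually_ge_atTop b] with i hi
      omega
  filter_upwards [h2.eventually (D.eventually_le_mul (show 0 < 1 / τ by positivity))] with i hi
  rw [one_div, inv_mul_eq_div, le_div_iff₀ (by linarith)] at hi
  have hx : (τ - 1) * logScale c (N (2 * i)) / Real.log A ≤ (τ - 1) * N (2 * i) := by
    rw [div_le_iff₀ D.log_A_pos, mul_assoc]
    exact mul_le_mul_of_nonneg_left (logScale_le D.two_lt D.B_le D.le_A _) (by linarith)
  rw [switchTime, Nat.cast_min]
  refine le_min ?_ ?_
  · push_cast
    linarith [Nat.lt_floor_add_one ((τ - 1) * logScale c (N (2 * i)) / Real.log A)]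
  · linarith

variable {θ : ℕ → ℝ} {x z α α' v m τ : ℝ}
  (hθ : IsTwoPhase N (switchTime A N c τ) x (1 / 2) z fun k => θ (k + 1))
  (hx : crossEntropy p x = v * Real.log A) (hm : crossEntropy p (1 / 2) = m * Real.log A)
  (hz : crossEntropy q z = α' * Real.log B)
include hθ hx hm hz

lemma frequently_le_sum_meanInfo {ε : ℝ} (hε : 0 < ε) : ∃ᶠ n in atTop,
    α' * logScale c n - ε * n ≤ ∑ k ∈ Finset.range n, meanInfo r θ k := by
  set K := |v * Real.log A - α' * Real.log A| + |m * Real.log A - α' * Real.log A| with hK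
  have hev := D.eventually_pred_le (show 0 < ε / (K + 1) by positivity)
  refine D.tendsto_two_mul.frequently (Eventually.frequently ?_)
  filter_upwards [hev] with i hi
  have h := (hθ.map D fun C ρ x => crossEntropy ρ x - α' * Real.log C).abs_sum_sub_le D i
  simp only [hx, hm, hz, sub_self, mul_zero, sub_zero, Finset.sum_sub_distrib, ← Finset.mul_sum]
    at h
  rw [← hK] at h
  simp only [meanInfo_eq]
  rw [div_mul_eq_mul_div, le_div_iff₀ (by positivity)] at hi
  have := (abs_le.1 h).1
  have hN0 : (0 : ℝ) ≤ N (2 * i - 1) := Nat.cast_nonneg _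
  rw [logScale]
  linarith

variable (hvα : v < α) (hαm : α ≤ m) (hmα' : m ≤ α') (hτ : τ - 1 = (α' - α) / (α - v))
include hvα hαm hmα'

lemma sum_meanInfo_le (n : ℕ) :
    ∑ k ∈ Finset.range n, meanInfo r θ k ≤ α' * logScale c n := by
  rw [logScale, Finset.mul_sum]
  refine Finset.sum_le_sum fun k _ => ?_
  have h := (hθ.map D fun C ρ x => crossEntropy ρ x - α' * Real.log C).cases D k
  simp only [hx, hm, hz] at h
  rw [meanInfo_eq]
  have := D.log_A_pos
  rcases h with h | h | h <;> nlinarith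

include hτ

lemma eventually_le_sum_meanInfo {ε : ℝ} (hε : 0 < ε) : ∀ᶠ n : ℕ in atTop,
    α * logScale c n - ε * n ≤ ∑ k ∈ Finset.range n, meanInfo r θ k := by
  have hτ1 : 1 ≤ τ := by
    have : 0 ≤ (α' - α) / (α - v) := div_nonneg (by linarith) (by linarith)
    linarith
  have h := (hθ.map D fun C ρ x => crossEntropy ρ x - α * Real.log C).eventually_neg_le D hτ1
    (D.switchTime_le hτ1) ?_ ?_ ?_ hε
  · filter_upwards [h] with n hn
    simp only [Finset.sum_sub_distrib, ← Finset.mul_sum] at hn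
    simp only [meanInfo_eq]
    rw [logScale]
    linarith
  · rw [hz]
    have := D.log_B_pos
    nlinarith
  · rw [hm]
    have := D.log_A_pos
    nlinarith
  · rw [hz, hx, hτ, ← sub_mul, ← sub_mul, mul_div_cancel_right₀ _ D.log_B_pos.ne',
      mul_div_cancel_right₀ _ D.log_A_pos.ne']
    have : α - v ≠ 0 := by linarith
    refine le_of_eq ?_
    field_simp
    ring

lemma frequently_sum_meanInfo_le {ε : ℝ} (hε : 0 < ε) : ∃ᶠ n in atTop,
    ∑ k ∈ Finset.range n, meanInfo r θ k ≤ α * logScale c n + ε * n := by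
  have hlA := D.log_A_pos
  have hτ1 : 1 ≤ τ := by
    have : 0 ≤ (α' - α) / (α - v) := div_nonneg (by linarith) (by linarith)
    linarith
  have hT : Tendsto (switchTime A N c τ) atTop atTop :=
    tendsto_atTop_mono (D.le_switchTime τ) D.tendsto_two_mul
  refine hT.frequently (Eventually.frequently ?_)
  filter_upwards [D.eventually_le_switchTime hτ1,
    (tendsto_natCast_atTop_atTop.comp hT).eventually_ge_atTop ((α - v) * Real.log A / ε)]
    with i hi hbig
  have hsum := (hθ.map D fun C ρ x => crossEntropy ρ x - α * Real.log C).sum_first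
    (D.le_switchTime τ i) le_rfl
  simp only [hx, Finset.sum_sub_distrib, ← Finset.mul_sum, ← meanInfo_eq] at hsum
  have hΛ : ∀ n, ∑ k ∈ Finset.range n, Real.log (c (k + 1)) = logScale c n := fun _ => rfl
  rw [hΛ, hΛ] at hsum
  have hle := D.sum_meanInfo_le hθ hx hm hz hvα hαm hmα' (N (2 * i))
  simp only [Function.comp] at hbig
  rw [div_le_iff₀ hε] at hbig
  have e1 : (switchTime A N c τ i - N (2 * i) : ℝ) * (v * Real.log A - α * Real.log A) ≤
      ((τ - 1) * logScale c (N (2 * i)) / Real.log A - 1) * (v * Real.log A - α * Real.log A) :=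
    mul_le_mul_of_nonpos_right (by linarith) (by nlinarith)
  have e2 : ((τ - 1) * logScale c (N (2 * i)) / Real.log A - 1) *
      (v * Real.log A - α * Real.log A) =
      -((α' - α) * logScale c (N (2 * i))) + (α - v) * Real.log A := by
    rw [hτ]
    have : α - v ≠ 0 := by linarith
    field_simp
    ring
  linarith

end IsAlternating

end

section

variable {A B p q : ℝ} {N : ℕ → ℕ} {c r : ℕ → ℝ}

lemma eventually_abs_le_of_tendsto_div {f : ℕ → ℝ}
    (hf : Tendsto (fun n : ℕ => f n / n) atTop (𝓝 0)) {ε : ℝ} (hε : 0 < ε) :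
    ∀ᶠ n : ℕ in atTop, |f n| ≤ ε * n := by
  filter_upwards [(tendsto_order.1 (hf.abs.trans (by simp))).2 ε hε, eventually_gt_atTop 0]
    with n hn hn0
  have : (0 : ℝ) < n := by exact_mod_cast hn0
  rw [abs_div, abs_of_pos this, div_lt_iff₀ this] at hn
  exact hn.le

lemma crossEntropy_half : crossEntropy (1 / 2) (1 / 2) = Real.log 2 := by
  rw [crossEntropy, show (1 : ℝ) - 1 / 2 = 1 / 2 by norm_num, one_div, Real.log_inv]
  ring

namespace IsAlternating

variable (D : IsAlternating A B p q N c r)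
include D

/-- The cylinders along which the local dimensions oscillate between `α` and `α'` carry a measure
whose exponent is controlled by the entropies of its three phases. -/
lemma le_dimH_level {μ : Measure ℝ} [IsProbabilityMeasure μ]
    (hμ : ∀ w : List Bool, μ (moranI c w) = ENNReal.ofReal (cylMass r w 1 1))
    {x z α α' v m t t' : ℝ} (hx0 : 0 < x) (hx1 : x < 1) (hz0 : 0 < z) (hz1 : z < 1)
    (hx : crossEntropy p x = v * Real.log A) (hm : crossEntropy p (1 / 2) = m * Real.log A)
    (hz : crossEntropy q z = α' * Real.log B)
    (hvα : v < α) (hαm : α ≤ m) (hmα' : m ≤ α') (ht : 0 < t) (htt' : t < t')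
    (hB : t' * Real.log B ≤ crossEntropy z z) (hA : t' * Real.log A ≤ Real.log 2)
    (hmix : t' * (1 + (α' - α) / (α - v)) ≤
      crossEntropy z z / Real.log B + (α' - α) / (α - v) * (crossEntropy x x / Real.log A)) :
    ENNReal.ofReal t ≤
      dimH {y | y ∈ moranSet c ∧ lowerLocalDim μ y = α ∧ upperLocalDim μ y = α'} := by
  have hlA := D.log_A_pos
  have hlB := D.log_B_pos
  set τ := 1 + (α' - α) / (α - v) with hτdef
  have hτ : τ - 1 = (α' - α) / (α - v) := by rw [hτdef]; ring
  have hτ1 : 1 ≤ τ := by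
    have : 0 ≤ (α' - α) / (α - v) := div_nonneg (by linarith) (by linarith)
    linarith
  obtain ⟨θ, hθ⟩ := exists_isTwoPhase N (switchTime A N c τ) D.mono (D.le_switchTime τ)
    (fun i => min_le_right _ _) x (1 / 2) z
  have hθ01 : ∀ k, 0 < θ (k + 1) ∧ θ (k + 1) < 1 := fun k => by
    rcases hθ.cases D k with h | h | h <;> rw [h]
    · exact ⟨hx0, hx1⟩
    · norm_num
    · exact ⟨hz0, hz1⟩
  obtain ⟨ρ, hρ0, hρ⟩ : ∃ ρ : ℝ, 0 < ρ ∧ ∀ k, ρ ≤ θ (k + 1) ∧ θ (k + 1) ≤ 1 - ρ := by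
    refine ⟨min (min x (1 - x)) (min (1 / 2) (min z (1 - z))), ?_, fun k => ?_⟩
    · have : 0 < 1 - x := by linarith
      have : 0 < 1 - z := by linarith
      positivity
    · have h1 : ∀ a b : ℝ, min a b ≤ a := fun a b => min_le_left _ _
      have h2 : ∀ a b : ℝ, min a b ≤ b := fun a b => min_le_right _ _
      have e1 := h1 (min x (1 - x)) (min (1 / 2) (min z (1 - z)))
      have e2 := h2 (min x (1 - x)) (min (1 / 2) (min z (1 - z)))
      have e3 := h1 x (1 - x)
      have e4 := h2 x (1 - x)
      have e5 := h1 (1 / 2) (min z (1 - z))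
      have e6 := h2 (1 / 2) (min z (1 - z))
      have e7 := h1 z (1 - z)
      have e8 := h2 z (1 - z)
      rcases hθ.cases D k with h | h | h <;> rw [h] <;> constructor <;> linarith
  have hr : ∀ k, min p q ≤ r (k + 1) ∧ r (k + 1) ≤ 1 - min p q := fun k => by
    have := D.r_mem k
    have := min_le_left p q
    have := D.p_le
    constructor <;> linarith [(D.r_mem k).1, (D.r_mem k).2]
  have : IsProbabilityMeasure (coinMeasure θ) := isProbabilityMeasure_coinMeasure hθ01
  set F : Set (ℕ → Bool) := {ω |
    Tendsto (fun n : ℕ => (logMass r n ω - ∑ k ∈ Finset.range n, meanInfo r θ k) / n)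
      atTop (𝓝 0) ∧
    Tendsto (fun n : ℕ => (logMass θ n ω - ∑ k ∈ Finset.range n, meanInfo θ θ k) / n)
      atTop (𝓝 0)} with hF
  have hFae : ∀ᵐ ω ∂coinMeasure θ, ω ∈ F := by
    filter_upwards [tendsto_logMass_sub hθ01 D.min_pos hr, tendsto_logMass_sub hθ01 hρ0 hρ]
      with ω h1 h2
    exact ⟨h1, h2⟩
  have hF0 : coinMeasure θ F ≠ 0 := fun h => by
    obtain ⟨ω, h1, h2⟩ := (hFae.and (measure_eq_zero_iff_ae_notMem.1 h)).exists
    exact h2 h1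
  have hΛ : ∀ n : ℕ, n * Real.log B ≤ logScale c n := logScale_ge D.two_lt D.B_le
  have hε : 0 < (t' - t) * Real.log B / 2 := by
    have : 0 < t' - t := by linarith
    positivity
  have hent := (hθ.map D fun C _ x => crossEntropy x x - t' * Real.log C).eventually_neg_le D hτ1
    (D.switchTime_le hτ1) (by linarith) (by rw [crossEntropy_half]; linarith) (by
      rw [← hτ] at hmix
      rw [sub_div, sub_div, mul_div_cancel_right₀ _ hlA.ne', mul_div_cancel_right₀ _ hlB.ne']
      linarith) hε
  refine (le_dimH_of_measure D.two_lt D.B_le ht (coinMeasure θ) F hF0 ?_).trans (dimH_mono ?_)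
  · rintro ω ⟨-, h2⟩
    filter_upwards [hent, eventually_abs_le_of_tendsto_div h2 hε] with n e1 e2
    rw [coinMeasure_cyl hθ01, scale, ← Real.exp_mul]
    refine ENNReal.ofReal_le_ofReal (Real.exp_le_exp.2 ?_)
    simp only [Finset.sum_sub_distrib, ← Finset.mul_sum, ← meanInfo_eq] at e1
    have e3 : ∑ k ∈ Finset.range n, Real.log (c (k + 1)) = logScale c n := rfl
    rw [e3] at e1
    have e4 := (abs_le.1 e2).1
    have e5 := mul_le_mul_of_nonneg_left (hΛ n) (show 0 ≤ t' - t by linarith)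
    linarith
  · rintro _ ⟨ω, ⟨h1, -⟩, rfl⟩
    obtain ⟨hl, hu⟩ := localDim_point D.two_lt D.B_le D.min_pos D.r_mem hμ D.le_A ω
    have hbd : ∀ᶠ n in atTop, |logMass r n ω / logScale c n| ≤
        -Real.log (min p q) / Real.log B := .of_forall fun n => by
      obtain ⟨h3, h4⟩ := ratio_mem D.two_lt D.B_le D.min_pos D.r_mem ω n
      rwa [abs_of_nonneg h3]
    have hstep : ∀ ε > 0, ∀ᶠ n : ℕ in atTop, 0 < logScale c n ∧ 0 < ε * Real.log B / 2 ∧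
        ε * Real.log B * n ≤ ε * logScale c n ∧
        |logMass r n ω - ∑ k ∈ Finset.range n, meanInfo r θ k| ≤ ε * Real.log B / 2 * n := by
      intro ε hε
      filter_upwards [eventually_abs_le_of_tendsto_div h1
        (show 0 < ε * Real.log B / 2 by positivity), eventually_gt_atTop 0] with n hn hn0
      refine ⟨D.logScale_pos hn0, by positivity, ?_, hn⟩
      have := mul_le_mul_of_nonneg_left (hΛ n) hε.le
      linarith
    refine ⟨(mem_moranSet_iff D.two_lt D.B_le).2 ⟨ω, rfl⟩, ?_, ?_⟩
    · rw [hl]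
      refine liminf_eq_of_frequently hbd (fun ε hε => ?_) (fun ε hε => ?_)
      · filter_upwards [hstep ε hε, D.eventually_le_sum_meanInfo hθ hx hm hz hvα hαm hmα' hτ
          (show 0 < ε * Real.log B / 2 by positivity)] with n ⟨g1, _, g2, g3⟩ g4
        rw [le_div_iff₀ g1]
        linarith [(abs_le.1 g3).1]
      · refine ((D.frequently_sum_meanInfo_le hθ hx hm hz hvα hαm hmα' hτ
          (show 0 < ε * Real.log B / 2 by positivity)).and_eventually (hstep ε hε)).mono ?_
        rintro n ⟨g4, g1, _, g2, g3⟩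
        rw [div_le_iff₀ g1]
        linarith [(abs_le.1 g3).2]
    · rw [hu]
      refine limsup_eq_of_frequently hbd (fun ε hε => ?_) (fun ε hε => ?_)
      · filter_upwards [hstep ε hε] with n ⟨g1, g0, g2, g3⟩
        have g4 := D.sum_meanInfo_le hθ hx hm hz hvα hαm hmα' n
        have := mul_nonneg g0.le (Nat.cast_nonneg (α := ℝ) n)
        rw [div_le_iff₀ g1]
        linarith [(abs_le.1 g3).2]
      · refine ((D.frequently_le_sum_meanInfo hθ hx hm hz
          (show 0 < ε * Real.log B / 2 by positivity)).and_eventually (hstep ε hε)).mono ?_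
        rintro n ⟨g4, g1, _, g2, g3⟩
        rw [le_div_iff₀ g1]
        linarith [(abs_le.1 g3).1]

end IsAlternating

end

section

variable {A B p q : ℝ} {N : ℕ → ℕ} {c r : ℕ → ℝ}

/-- The Gibbs probability at inverse temperature `s` of the first of the weights `ρ`, `1 - ρ`. -/
noncomputable def gibbs (ρ s : ℝ) : ℝ := ρ ^ s / (ρ ^ s + (1 - ρ) ^ s)

section Gibbs

variable {ρ : ℝ} (h0 : 0 < ρ) (h1 : ρ < 1)
include h0 h1

lemma one_sub_gibbs (s : ℝ) : 1 - gibbs ρ s = (1 - ρ) ^ s / (ρ ^ s + (1 - ρ) ^ s) := by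
  have := partition_pos h0 h1 s
  rw [gibbs]
  field_simp
  ring

lemma gibbs_mem (s : ℝ) : 0 < gibbs ρ s ∧ gibbs ρ s < 1 := by
  have hZ := partition_pos h0 h1 s
  have h2 := Real.rpow_pos_of_pos h0 s
  have h3 := Real.rpow_pos_of_pos (sub_pos.2 h1) s
  have h4 : 0 < 1 - gibbs ρ s := by
    rw [one_sub_gibbs h0 h1]
    positivity
  exact ⟨div_pos h2 hZ, by linarith⟩

lemma crossEntropy_gibbs (s : ℝ) {C : ℝ} (hC : 1 < C) :
    crossEntropy ρ (gibbs ρ s) = deriv (betaFn ρ C) s * Real.log C := by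
  have := partition_pos h0 h1 s
  have := Real.log_pos hC
  rw [(hasDerivAt_betaFn h0 h1 s).deriv, crossEntropy, one_sub_gibbs h0 h1, gibbs]
  field_simp
  ring

lemma entropy_gibbs (s : ℝ) :
    crossEntropy (gibbs ρ s) (gibbs ρ s) =
      s * crossEntropy ρ (gibbs ρ s) + Real.log (ρ ^ s + (1 - ρ) ^ s) := by
  have hZ := partition_pos h0 h1 s
  have h2 := Real.rpow_pos_of_pos h0 s
  have h3 := Real.rpow_pos_of_pos (sub_pos.2 h1) s
  have e1 : Real.log (gibbs ρ s) = s * Real.log ρ - Real.log (ρ ^ s + (1 - ρ) ^ s) := by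
    rw [gibbs, Real.log_div h2.ne' hZ.ne', Real.log_rpow h0]
  have e2 : Real.log (1 - gibbs ρ s) =
      s * Real.log (1 - ρ) - Real.log (ρ ^ s + (1 - ρ) ^ s) := by
    rw [one_sub_gibbs h0 h1, Real.log_div h3.ne' hZ.ne', Real.log_rpow (sub_pos.2 h1)]
  rw [crossEntropy, e1, e2, crossEntropy]
  ring

lemma exists_gibbs_eq (hρ : ρ < 1 / 2) {z : ℝ} (hz0 : 0 < z) (hz1 : z < 1) :
    ∃ s, gibbs ρ s = z := by
  have h3 : 0 < 1 - ρ := sub_pos.2 h1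
  have h4 : 0 < 1 - z := sub_pos.2 hz1
  have hlog : Real.log ρ - Real.log (1 - ρ) ≠ 0 :=
    (sub_neg.2 (Real.log_lt_log h0 (by linarith))).ne
  set s := (Real.log z - Real.log (1 - z)) / (Real.log ρ - Real.log (1 - ρ)) with hs
  have key : ρ ^ s * (1 - z) = (1 - ρ) ^ s * z := by
    rw [Real.rpow_def_of_pos h0, Real.rpow_def_of_pos h3]
    nth_rewrite 1 [← Real.exp_log h4]
    nth_rewrite 2 [← Real.exp_log hz0]
    rw [← Real.exp_add, ← Real.exp_add]
    congr 1
    have : s * (Real.log ρ - Real.log (1 - ρ)) = Real.log z - Real.log (1 - z) :=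
      div_mul_cancel₀ _ hlog
    linarith
  refine ⟨s, ?_⟩
  rw [gibbs, div_eq_iff (partition_pos h0 h1 s).ne']
  linarith

end Gibbs

section Legendre

variable {ρ C a : ℝ} (h0 : 0 < ρ) (h1 : ρ < 1) (hC : 1 < C)
include h0 h1 hC

lemma bddBelow_range_mul_sub_betaFn (ha : -Real.log (1 - ρ) / Real.log C ≤ a)
    (ha' : a ≤ -Real.log ρ / Real.log C) :
    BddBelow (range fun s : ℝ => s * a - betaFn ρ C s) := by
  have hlC := Real.log_pos hC
  refine ⟨0, ?_⟩
  rintro _ ⟨s, rfl⟩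
  have h2 := Real.rpow_pos_of_pos h0 s
  have h3 := Real.rpow_pos_of_pos (sub_pos.2 h1) s
  rw [div_le_iff₀ hlC] at ha
  rw [le_div_iff₀ hlC] at ha'
  have e1 : s * Real.log ρ ≤ Real.log (ρ ^ s + (1 - ρ) ^ s) := by
    rw [← Real.log_rpow h0]
    exact Real.log_le_log h2 (by linarith)
  have e2 : s * Real.log (1 - ρ) ≤ Real.log (ρ ^ s + (1 - ρ) ^ s) := by
    rw [← Real.log_rpow (sub_pos.2 h1)]
    exact Real.log_le_log h3 (by linarith)
  have e3 : 0 ≤ s * (a * Real.log C) + Real.log (ρ ^ s + (1 - ρ) ^ s) := by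
    rcases le_total 0 s with hs | hs <;> nlinarith
  have e4 : s * a - betaFn ρ C s =
      (s * (a * Real.log C) + Real.log (ρ ^ s + (1 - ρ) ^ s)) / Real.log C := by
    rw [betaFn]
    field_simp
    ring
  beta_reduce
  rw [e4]
  positivity

/-- The Legendre transform of `betaFn ρ C` is not positive at the left end point. -/
lemma legendre_betaFn_nonpos (hρ : ρ < 1 / 2) :
    legendre (betaFn ρ C) (-Real.log (1 - ρ) / Real.log C) ≤ 0 := by
  have hlC := Real.log_pos hC
  have h3 : 0 < 1 - ρ := sub_pos.2 h1
  refine le_of_forall_pos_le_add fun ε hε => ?_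
  obtain ⟨n, hn⟩ := exists_pow_lt_of_lt_one (show 0 < ε * Real.log C by positivity)
    (show ρ / (1 - ρ) < 1 by rw [div_lt_one h3]; linarith)
  refine (ciInf_le (bddBelow_range_mul_sub_betaFn h0 h1 hC le_rfl ?_) (n : ℝ)).trans ?_
  · exact div_le_div_of_nonneg_right (neg_le_neg (Real.log_le_log h0 (by linarith))) hlC.le
  · have e1 : ρ ^ n + (1 - ρ) ^ n = (1 - ρ) ^ n * (1 + (ρ / (1 - ρ)) ^ n) := by
      rw [div_pow]
      field_simp
      ring
    have e2 : 0 < (ρ / (1 - ρ)) ^ n := by positivity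
    rw [betaFn, Real.rpow_natCast, Real.rpow_natCast, e1, Real.log_mul (by positivity) (by positivity),
      Real.log_pow]
    have e3 := Real.log_le_sub_one_of_pos (show 0 < 1 + (ρ / (1 - ρ)) ^ n by positivity)
    have e4 : (n : ℝ) * (-Real.log (1 - ρ) / Real.log C) -
        -(n * Real.log (1 - ρ) + Real.log (1 + (ρ / (1 - ρ)) ^ n)) / Real.log C =
        Real.log (1 + (ρ / (1 - ρ)) ^ n) / Real.log C := by ring
    rw [e4, zero_add, div_le_iff₀ hlC]
    linarith

lemma exists_legendre_le_entropy (hρ : ρ < 1 / 2) (ha : -Real.log (1 - ρ) / Real.log C < a)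
    (ha' : a < -Real.log ρ / Real.log C) : ∃ z, 0 < z ∧ z < 1 ∧
      crossEntropy ρ z = a * Real.log C ∧
      legendre (betaFn ρ C) a * Real.log C ≤ crossEntropy z z := by
  have hlC := Real.log_pos hC
  have hbdd := bddBelow_range_mul_sub_betaFn h0 h1 hC ha.le ha'.le
  have hlog : 0 < Real.log (1 - ρ) - Real.log ρ :=
    sub_pos.2 (Real.log_lt_log h0 (by linarith))
  rw [div_lt_iff₀ hlC] at ha
  rw [lt_div_iff₀ hlC] at ha'
  set z := (a * Real.log C + Real.log (1 - ρ)) / (Real.log (1 - ρ) - Real.log ρ) with hz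
  have hz0 : 0 < z := div_pos (by linarith) hlog
  have hz1 : z < 1 := (div_lt_one hlog).2 (by linarith)
  have hza : crossEntropy ρ z = a * Real.log C := by
    have : z * (Real.log (1 - ρ) - Real.log ρ) = a * Real.log C + Real.log (1 - ρ) :=
      div_mul_cancel₀ _ hlog.ne'
    rw [crossEntropy]
    linarith
  refine ⟨z, hz0, hz1, hza, ?_⟩
  obtain ⟨s, hs⟩ := exists_gibbs_eq h0 h1 hρ hz0 hz1
  have h := entropy_gibbs h0 h1 s
  rw [hs, hza] at h
  have h2 : legendre (betaFn ρ C) a ≤ s * a - betaFn ρ C s := ciInf_le hbdd s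
  refine (mul_le_mul_of_nonneg_right h2 hlC.le).trans (le_of_eq ?_)
  rw [h, betaFn]
  field_simp
  ring

end Legendre

lemma continuousAt_entropy {x : ℝ} (h0 : 0 < x) (h1 : x < 1) :
    ContinuousAt (fun x => crossEntropy x x) x := by
  have h2 : 1 - x ≠ 0 := by linarith
  have h3 := h0.ne'
  unfold crossEntropy
  fun_prop (disch := assumption)

lemma continuous_crossEntropy (ρ : ℝ) : Continuous (crossEntropy ρ) := by
  unfold crossEntropy
  fun_prop

namespace IsAlternating

variable (D : IsAlternating A B p q N c r)
include D

lemma le_dimH_level_min {μ : Measure ℝ} [IsProbabilityMeasure μ]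
    (hμ : ∀ w : List Bool, μ (moranI c w) = ENNReal.ofReal (cylMass r w 1 1))
    (hpq : -Real.log p / Real.log A < -Real.log (1 - q) / Real.log B)
    {α α' s₁ : ℝ} (hα'1 : -Real.log (1 - q) / Real.log B ≤ α')
    (hα'2 : α' < deriv (betaFn q B) 1) (hs0 : 0 ≤ s₁)
    (htan : legendre (betaFn q B) α' = s₁ * α' - betaFn p A s₁)
    (hα1 : deriv (betaFn p A) s₁ ≤ α) (hα2 : α < deriv (betaFn p A) 0) :
    ENNReal.ofReal (min (Real.log 2 / Real.log A) (s₁ * α - betaFn p A s₁)) ≤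
      dimH {x | x ∈ moranSet c ∧ lowerLocalDim μ x = α ∧ upperLocalDim μ x = α'} := by
  have hlA := D.log_A_pos
  have hlB := D.log_B_pos
  have hA1 : 1 < A := by linarith [D.two_lt, D.lt]
  have hB1 : 1 < B := by linarith [D.two_lt]
  have hp0 := D.p_pos
  have hq0 := D.q_pos
  have hp1 : p < 1 := by linarith [D.p_le]
  have hq1 : q < 1 := by linarith [D.q_le]
  have hq1' : deriv (betaFn q B) 1 * Real.log B = crossEntropy q q := by
    rw [← crossEntropy_gibbs hq0 hq1 1 hB1]
    simp [gibbs]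
  have hpg := crossEntropy_gibbs hp0 hp1 s₁ hA1
  have hp0' := crossEntropy_gibbs hp0 hp1 0 hA1
  have hg0 : gibbs p 0 = 1 / 2 := by norm_num [gibbs]
  rw [hg0] at hp0'
  have hp2 : p < 1 / 2 := by
    refine lt_of_le_of_ne D.p_le ?_
    rintro rfl
    have : ∀ x, crossEntropy (1 / 2) x = Real.log 2 := fun x => by
      rw [crossEntropy, show (1 : ℝ) - 1 / 2 = 1 / 2 by norm_num, one_div, Real.log_inv]
      ring
    rw [this] at hpg hp0'
    nlinarith
  have hq2 : q < 1 / 2 := by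
    refine lt_of_le_of_ne D.q_le ?_
    rintro rfl
    have h := hα'1.trans_lt hα'2
    rw [div_lt_iff₀ hlB, hq1', crossEntropy_half,
      show (1 : ℝ) - 1 / 2 = 2⁻¹ by norm_num, Real.log_inv, neg_neg] at h
    exact h.false
  have hα'3 : α' < -Real.log q / Real.log B := by
    rw [lt_div_iff₀ hlB]
    refine (mul_lt_mul_of_pos_right hα'2 hlB).trans_le ?_
    rw [hq1', crossEntropy]
    have := Real.log_le_log hq0 (show q ≤ 1 - q by linarith)
    nlinarith
  have hmα' : deriv (betaFn p A) 0 < α' := by linarith [D.deriv_zero_le]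
  have hsα : 0 ≤ s₁ * (α' - α) := mul_nonneg hs0 (by linarith)
  refine le_of_forall_lt_imp_le_of_dense fun a ha => ?_
  obtain ⟨t, rfl⟩ : ∃ t : ℝ, a = ENNReal.ofReal t :=
    ⟨a.toReal, (ENNReal.ofReal_toReal (ha.trans_le le_top).ne).symm⟩
  rcases le_or_gt t 0 with ht0 | ht0
  · rw [ENNReal.ofReal_of_nonpos ht0]
    exact bot_le
  obtain ⟨ht, -⟩ := ENNReal.ofReal_lt_ofReal_iff'.1 ha
  obtain ⟨t', htt', ht'⟩ := exists_between ht
  obtain ⟨ht'1, ht'2⟩ := lt_min_iff.1 ht'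
  have hα'4 : -Real.log (1 - q) / Real.log B < α' := by
    refine lt_of_le_of_ne hα'1 fun h => ?_
    have := legendre_betaFn_nonpos hq0 hq1 hB1 hq2
    rw [h, htan] at this
    linarith
  obtain ⟨z, hz0, hz1, hz, hzL⟩ := exists_legendre_le_entropy hq0 hq1 hB1 hq2 hα'4 hα'3
  obtain ⟨hx0, hx1⟩ := gibbs_mem hp0 hp1 s₁
  have hcont : ContinuousAt (fun x =>
      (α - crossEntropy p x / Real.log A) * legendre (betaFn q B) α' +
        (α' - α) * (crossEntropy x x / Real.log A) -
        t' * (α' - crossEntropy p x / Real.log A)) (gibbs p s₁) := by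
    have := continuousAt_entropy hx0 hx1
    have := (continuous_crossEntropy p).continuousAt (x := gibbs p s₁)
    fun_prop
  have hval : 0 < (α - crossEntropy p (gibbs p s₁) / Real.log A) * legendre (betaFn q B) α' +
        (α' - α) * (crossEntropy (gibbs p s₁) (gibbs p s₁) / Real.log A) -
        t' * (α' - crossEntropy p (gibbs p s₁) / Real.log A) := by
    have e : crossEntropy (gibbs p s₁) (gibbs p s₁) / Real.log A =
        s₁ * deriv (betaFn p A) s₁ - betaFn p A s₁ := by
      rw [entropy_gibbs hp0 hp1, hpg, betaFn]
      field_simp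
      ring
    rw [e, hpg, mul_div_cancel_right₀ _ hlA.ne', htan]
    have := mul_pos (sub_pos.2 ht'2) (show 0 < α' - deriv (betaFn p A) s₁ by linarith)
    linarith
  obtain ⟨x, ⟨hxΦ, hx0'⟩, hxg⟩ := (((hcont.eventually_const_lt hval).and
    (lt_mem_nhds hx0)).filter_mono nhdsWithin_le_nhds |>.and
    (eventually_mem_nhdsWithin (s := Iio (gibbs p s₁)))).exists
  rw [mem_Iio] at hxg
  have hv : crossEntropy p x / Real.log A < α := by
    refine lt_of_lt_of_le ?_ hα1
    rw [div_lt_iff₀ hlA, ← hpg, crossEntropy, crossEntropy]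
    have := Real.log_lt_log hp0 (show p < 1 - p by linarith)
    nlinarith
  have hαv : 0 < α - crossEntropy p x / Real.log A := sub_pos.2 hv
  refine D.le_dimH_level hμ hx0' (hxg.trans hx1) hz0 hz1 (div_mul_cancel₀ _ hlA.ne').symm hp0' hz hv
    hα2.le hmα'.le ht0 htt' (le_trans (mul_le_mul_of_nonneg_right ?_ hlB.le) hzL)
    ((lt_div_iff₀ hlA).1 ht'1).le ?_
  · rw [htan]
    linarith
  · have hzL' := (le_div_iff₀ hlB).2 hzL
    refine le_trans ?_ (add_le_add_left hzL' _)
    rw [← sub_nonneg]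
    have e : legendre (betaFn q B) α' + (α' - α) / (α - crossEntropy p x / Real.log A) *
        (crossEntropy x x / Real.log A) -
        t' * (1 + (α' - α) / (α - crossEntropy p x / Real.log A)) =
        ((α - crossEntropy p x / Real.log A) * legendre (betaFn q B) α' +
        (α' - α) * (crossEntropy x x / Real.log A) -
        t' * (α' - crossEntropy p x / Real.log A)) / (α - crossEntropy p x / Real.log A) := by
      generalize crossEntropy p x / Real.log A = v at *
      field_simp
      ring
    rw [e]
    exact (div_pos hxΦ hαv).le

end IsAlternating

end

end Moran

/-- suppose β₂'(+∞) ≤ α' < β₂'(1) and s₁ ∈ [0,1] satisfies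
β₂^*(α') = s₁·α' − β₁(s₁) (so that the line y = s₁·x − β₁(s₁), tangent to the graph of
β₁^* at g(α') := β₁'(s₁), passes through (α', β₂^*(α'))).  Then for every α with
β₁'(s₁) ≤ α < β₁'(0), dim_H E(μ,α,α') = min{log 2/log A, s₁·α − β₁(s₁)}. -/
theorem stmt_12 (A B p q : ℝ) (N : ℕ → ℕ)
    (hBA : B < A) (hB2 : 2 < B)
    (hp0 : 0 < p) (hp2 : p ≤ 1 / 2) (hq0 : 0 < q) (hq2 : q ≤ 1 / 2)
    (hN0 : N 0 = 0) (hNmono : StrictMono N)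
    (hNlim : Tendsto (fun i : ℕ => (N (i + 1) : ℝ) / (N i : ℝ)) atTop atTop)
    (hpq : -Real.log p / Real.log A < -Real.log (1 - q) / Real.log B)
    (c r : ℕ → ℝ)
    (hcA : ∀ i n : ℕ, N (2 * i) < n → n ≤ N (2 * i + 1) → c n = A)
    (hcB : ∀ i n : ℕ, N (2 * i + 1) < n → n ≤ N (2 * i + 2) → c n = B)
    (hrp : ∀ i n : ℕ, N (2 * i) < n → n ≤ N (2 * i + 1) → r n = p)
    (hrq : ∀ i n : ℕ, N (2 * i + 1) < n → n ≤ N (2 * i + 2) → r n = q)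
    (μ : Measure ℝ) [IsProbabilityMeasure μ]
    (hμ : ∀ w : List Bool, μ (moranI c w) = ENNReal.ofReal (cylMass r w 1 1))
    (α α' s₁ : ℝ)
    (hα'1 : -Real.log (1 - q) / Real.log B ≤ α') (hα'2 : α' < deriv (betaFn q B) 1)
    (hs₁0 : 0 ≤ s₁) (hs₁1 : s₁ ≤ 1)
    (htan : legendre (betaFn q B) α' = s₁ * α' - betaFn p A s₁)
    (hg : deriv (betaFn p A) s₁ ≤ deriv (betaFn p A) 0)
    (hα1 : deriv (betaFn p A) s₁ ≤ α) (hα2 : α < deriv (betaFn p A) 0) :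
    dimH {x | x ∈ moranSet c ∧ lowerLocalDim μ x = α ∧ upperLocalDim μ x = α'} =
      ENNReal.ofReal (min (Real.log 2 / Real.log A) (s₁ * α - betaFn p A s₁)) := by
  have D : Moran.IsAlternating A B p q N c r :=
    ⟨hBA, hB2, hp0, hp2, hq0, hq2, hN0, hNmono, hNlim,
      fun i k h1 h2 => ⟨hcA i (k + 1) (by omega) (by omega), hrp i (k + 1) (by omega) (by omega)⟩,
      fun i k h1 h2 => ⟨hcB i (k + 1) (by omega) (by omega), hrq i (k + 1) (by omega) (by omega)⟩⟩
  exact le_antisymm (D.dimH_level_le_min hμ hpq hα'2 hs₁0 hs₁1 htan hα2)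
    (D.le_dimH_level_min hμ hpq hα'1 hα'2 hs₁0 htan hα1 hα2)
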